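/- arXiv:2302.07664 — 2 statements merged into one kernel-verified Lean document; each statement's English description precedes it below -/
import Mathlib

section
/- There is an absolute constant C > 0 such that for every odd prime power q, every integer r ≥ 1, every λ = (λ₁,…,λ_r) ∈ ℕ^r, and every integer n ≥ 1: | q^{−n} · Σ_{d ∈ 𝒫_n} N_λ(d) − (1 − q^{−1}) · M_λ | ≤ C · 5^{|λ|} · q^{|λ| − n/2}, where M_λ := Σ over r-tuples (m₁,…,m_r) of monic polynomials with deg m_i = λ_i such that the product m₁⋯m_r is a square, say m₁⋯m_r = v² with v monic, of ∏_{p ∣ v} (1 + |p|^{−1})^{−1}, the product being over monic irreducible divisors p of v. (In particular M_λ = 0 when |λ| is odd, since then no such tuple exists.) -/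
/-!
Let `q` be an odd prime power and `F = F_q`.  With `χ_d`, `N_λ(d)`, `𝒫_n` as in the
context, and
`M_λ := Σ_{(m₁,…,m_r) : m₁⋯m_r = v², v monic} ∏_{p ∣ v} (1+|p|⁻¹)⁻¹`
(the product over the monic irreducible divisors `p` of `v`, `|p| = q^{deg p}`),

Statement: there is an absolute constant `C > 0` such that for every odd prime power
`q`, every `r ≥ 1`, every `λ ∈ ℕ^r` and every `n ≥ 1`,
`| q^{−n} Σ_{d ∈ 𝒫_n} N_λ(d) − (1−q⁻¹)·M_λ | ≤ C · 5^{|λ|} · q^{|λ|−n/2}`.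
-/

noncomputable section
open scoped Classical
open Polynomial UniqueFactorizationMonoid

namespace Stmt6

variable (F : Type) [Field F] [Fintype F]

lemma finite_natDegree_le (n : ℕ) : {m : F[X] | m.natDegree ≤ n}.Finite := by
  refine Set.Finite.of_finite_image (f := fun m : F[X] => fun k : Fin (n + 1) => m.coeff k)
    (Set.toFinite _) ?_
  intro a ha b hb h
  ext k
  by_cases hk : k ≤ n
  · simpa using congrFun h ⟨k, Nat.lt_succ_of_le hk⟩
  · rw [Polynomial.coeff_eq_zero_of_natDegree_lt (lt_of_le_of_lt ha (by omega)),
        Polynomial.coeff_eq_zero_of_natDegree_lt (lt_of_le_of_lt hb (by omega))]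

/-- Monic polynomials of degree `n`. -/
abbrev MD (n : ℕ) : Type := {m : F[X] // m.Monic ∧ m.natDegree = n}

instance (n : ℕ) : Finite (MD F n) :=
  Set.Finite.to_subtype ((finite_natDegree_le F n).subset (fun _ hm => le_of_eq hm.2))

noncomputable instance (n : ℕ) : Fintype (MD F n) := Fintype.ofFinite _

/-- Monic squarefree polynomials of degree `n` (the set `𝒫_n`). -/
abbrev SF (n : ℕ) : Type := {d : F[X] // d.Monic ∧ Squarefree d ∧ d.natDegree = n}

instance (n : ℕ) : Finite (SF F n) :=
  Set.Finite.to_subtype ((finite_natDegree_le F n).subset (fun _ hm => le_of_eq hm.2.2))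

noncomputable instance (n : ℕ) : Fintype (SF F n) := Fintype.ofFinite _

/-- The quadratic residue symbol `(a/p)` for an irreducible modulus `p`:
`0` if `p ∣ a`, `1` if `a` is a nonzero square mod `p`, and `−1` otherwise. -/
def legP (a p : F[X]) : ℤ :=
  if p ∣ a then 0 else if ∃ b : F[X], p ∣ (b ^ 2 - a) then 1 else -1

/-- `χ_a(m) = (a/m)`: the product of `(a/pᵢ)` over the factorization `m = p₁⋯p_k` of `m`
into monic irreducibles (for monic `m`; `(a/1) = 1`). -/
def chi (a m : F[X]) : ℤ := ((normalizedFactors m).map (legP F a)).prod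

/-- Tuples `(m₁,…,m_r)` of monic polynomials with `deg m_i = λ_i`. -/
abbrev Tup {r : ℕ} (lam : Fin r → ℕ) : Type := (i : Fin r) → MD F (lam i)

/-- `N_λ(d) = Σ_{(m₁,…,m_r)} ∏_i χ_d(m_i)`. -/
def Nlam {r : ℕ} (lam : Fin r → ℕ) (d : F[X]) : ℤ :=
  ∑ t : Tup F lam, ∏ i, chi F d (t i : F[X])

/-- The contribution of a tuple to `M_λ`: if `m₁⋯m_r = v²` with `v` monic (such a `v`
is unique when it exists), this is `∏_{p ∣ v} (1+|p|⁻¹)⁻¹`, the product over the monic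
irreducible divisors `p` of `v`; otherwise `0`. -/
def Mterm (q : ℕ) {r : ℕ} {lam : Fin r → ℕ} (t : Tup F lam) : ℝ :=
  if h : ∃ v : F[X], v.Monic ∧ (∏ i, ((t i : F[X]))) = v ^ 2 then
    ∏ p ∈ (normalizedFactors h.choose).toFinset, ((1 : ℝ) + ((q : ℝ) ^ p.natDegree)⁻¹)⁻¹
  else 0

/-- `M_λ = Σ_{(m₁,…,m_r) : m₁⋯m_r = v²} ∏_{p ∣ v} (1+|p|⁻¹)⁻¹`. -/
def Mlam (q : ℕ) {r : ℕ} (lam : Fin r → ℕ) : ℝ := ∑ t : Tup F lam, Mterm F q t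


set_option linter.unusedSectionVars false
set_option linter.unusedVariables false

lemma stepanov_ker {K : Type} [Field K] (f : K[X]) (R J A e : ℕ) (eps : K)
    (hJ : 0 < J)
    (hcount : R * A + f.natDegree * e + J < 2 * J * (A + 1)) :
    ∃ α : Fin 2 → Fin J → Fin (A + 1) → K, α ≠ 0 ∧
      ∑ j : Fin J, ((∑ i : Fin (A + 1), C (α 0 j i) * X ^ (R * (i : ℕ))) +
        C eps * (∑ i : Fin (A + 1), C (α 1 j i) * X ^ (R * (i : ℕ))) * f ^ e) * X ^ (j : ℕ) = 0 := by
  let N := R * A + f.natDegree * e + J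
  let T : (Fin 2 → Fin J → Fin (A + 1) → K) →ₗ[K] K[X] :=
    { toFun := fun α => ∑ j : Fin J, ((∑ i : Fin (A + 1), C (α 0 j i) * X ^ (R * (i : ℕ))) +
        C eps * (∑ i : Fin (A + 1), C (α 1 j i) * X ^ (R * (i : ℕ))) * f ^ e) * X ^ (j : ℕ)
      map_add' := by
        intro x y
        simp only [Pi.add_apply, C_add, add_mul, Finset.sum_add_distrib, mul_add]
        ring
      map_smul' := by
        intro c x
        simp only [Pi.smul_apply, smul_eq_mul, C_mul, RingHom.id_apply, smul_eq_C_mul,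
          Finset.mul_sum, Finset.sum_mul, mul_add, add_mul, Finset.sum_add_distrib]
        congr 1
        · refine Finset.sum_congr rfl fun j _ => Finset.sum_congr rfl fun i _ => by ring
        · refine Finset.sum_congr rfl fun j _ => Finset.sum_congr rfl fun i _ => by ring }
  have hT : ∀ α, T α ∈ degreeLT K N := by
    intro α
    change (∑ j : Fin J, _) ∈ degreeLT K N
    refine Submodule.sum_mem _ fun j _ => ?_
    rw [mem_degreeLT]
    have h1 : ∀ g : Fin (A + 1) → K, (∑ i : Fin (A + 1), C (g i) * X ^ (R * (i : ℕ))).natDegree ≤ R * A := by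
      intro g
      refine natDegree_sum_le_of_forall_le _ _ fun i _ => ?_
      refine (natDegree_C_mul_X_pow_le _ _).trans ?_
      exact Nat.mul_le_mul_left _ (by omega)
    have h2 : (((∑ i : Fin (A + 1), C (α 0 j i) * X ^ (R * (i : ℕ))) +
        C eps * (∑ i : Fin (A + 1), C (α 1 j i) * X ^ (R * (i : ℕ))) * f ^ e) * X ^ (j : ℕ)).natDegree
        ≤ R * A + f.natDegree * e + j := by
      refine natDegree_mul_le.trans (Nat.add_le_add ?_ (natDegree_X_pow_le _))
      refine (natDegree_add_le _ _).trans (max_le ((h1 _).trans (by omega)) ?_)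
      refine natDegree_mul_le.trans (Nat.add_le_add ((natDegree_C_mul_le _ _).trans (h1 _)) ?_)
      exact natDegree_pow_le.trans (by rw [mul_comm])
    refine lt_of_le_of_lt degree_le_natDegree ?_
    have : R * A + f.natDegree * e + (j : ℕ) < N := by
      simp only [N]; omega
    exact_mod_cast lt_of_le_of_lt h2 this
  let T' := T.codRestrict (degreeLT K N) hT
  have hlt : Module.finrank K (degreeLT K N) < Module.finrank K (Fin 2 → Fin J → Fin (A + 1) → K) := by
    rw [(degreeLTEquiv K N).finrank_eq]
    simp only [Module.finrank_pi, Module.finrank_pi_fintype, Fintype.card_fin, Finset.sum_const, Finset.card_univ, smul_eq_mul]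
    simp only [N]
    linarith
  have : FiniteDimensional K (degreeLT K N) := (degreeLTEquiv K N).symm.finiteDimensional
  have hk := LinearMap.ker_ne_bot_of_finrank_lt (f := T') hlt
  obtain ⟨α, hα, hα0⟩ := (Submodule.ne_bot_iff _).1 hk
  refine ⟨α, hα0, ?_⟩
  have := congrArg Subtype.val (LinearMap.mem_ker.1 hα)
  exact this

lemma X_pow_mod {K : Type} [Field K] (p h : ℕ) [Fact p.Prime] [CharP K p] (f : K[X]) :
    (X : K[X]) ^ (p ^ h) ∣ f ^ (p ^ h) - C (f.eval 0 ^ (p ^ h)) := by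
  have h1 : (X : K[X]) ∣ f - C (f.eval 0) := by
    have := dvd_iff_isRoot (p := f - C (f.eval 0)) (a := (0 : K))
    simp only [C_0, sub_zero] at this
    rw [this]; simp
  have h2 := pow_dvd_pow_of_dvd h1 (p ^ h)
  rw [sub_pow_char_pow] at h2
  simpa using h2

/-- Nonvanishing step. -/
lemma stepanov_nonvanish {K : Type} [Field K] (p h : ℕ) [Fact p.Prime] [CharP K p] (f : K[X])
    (t : ℕ) (hR : p ^ h = 2 * t + 1)
    (hns : ∀ (c : K) (a b : K[X]), c ≠ 0 → C c * f * b ^ 2 = a ^ 2 → b = 0)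
    (h0 : f.eval 0 ≠ 0) (A : ℕ) (hA : 2 * A + f.natDegree < p ^ h) :
    ∀ (J : ℕ) (a b : ℕ → K[X]), (∀ j, (a j).natDegree ≤ A) → (∀ j, (b j).natDegree ≤ A) →
      ∑ j ∈ Finset.range J, (a j + b j * f ^ (t + 1)) * X ^ (p ^ h * j) = 0 →
      ∀ j < J, a j = 0 ∧ b j = 0 := by
  intro J
  induction J with
  | zero => intro a b _ _ _ j hj; omega
  | succ J ih =>
    intro a b ha hb hs
    set R := p ^ h with hRdef
    have key : a 0 = 0 ∧ b 0 = 0 := by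
      rw [Finset.sum_range_succ'] at hs
      simp only [mul_zero, pow_zero, mul_one] at hs
      have hd : (X : K[X]) ^ R ∣ a 0 + b 0 * f ^ (t + 1) := by
        have : a 0 + b 0 * f ^ (t + 1) = - ∑ k ∈ Finset.range J, (a (k + 1) + b (k + 1) * f ^ (t + 1)) * X ^ (R * (k + 1)) := by
          rw [eq_neg_iff_add_eq_zero, add_comm]; exact hs
        rw [this, dvd_neg]
        refine Finset.dvd_sum fun k _ => ?_
        refine Dvd.dvd.mul_left (pow_dvd_pow _ ?_) _
        nlinarith
      have hd2 : (X : K[X]) ^ R ∣ (a 0) ^ 2 - (b 0) ^ 2 * f * f ^ R := by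
        have : (a 0) ^ 2 - (b 0) ^ 2 * f * f ^ R = (a 0 + b 0 * f ^ (t + 1)) * (a 0 - b 0 * f ^ (t + 1)) := by
          rw [hR]; ring
        rw [this]; exact hd.mul_right _
      have hd3 : (X : K[X]) ^ R ∣ (a 0) ^ 2 - C (f.eval 0 ^ R) * f * (b 0) ^ 2 := by
        have h3 := (X_pow_mod p h f).mul_left ((b 0) ^ 2 * f)
        have := dvd_add hd2 h3
        refine this.trans (dvd_of_eq ?_)
        rw [← hRdef]; ring
      have hz : (a 0) ^ 2 - C (f.eval 0 ^ R) * f * (b 0) ^ 2 = 0 := by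
        refine eq_zero_of_dvd_of_natDegree_lt hd3 ?_
        rw [natDegree_X_pow]
        refine lt_of_le_of_lt (natDegree_sub_le _ _) (max_lt ?_ ?_)
        · have := natDegree_pow_le (p := a 0) (n := 2)
          have := ha 0
          omega
        · have h4 := natDegree_mul_le (p := C (f.eval 0 ^ R) * f) (q := b 0 ^ 2)
          have h5 := natDegree_C_mul_le (f.eval 0 ^ R) f
          have h6 := natDegree_pow_le (p := b 0) (n := 2)
          have := hb 0
          omega
      have hb0 : b 0 = 0 := hns _ (a 0) (b 0) (pow_ne_zero _ h0) (sub_eq_zero.1 hz).symm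
      rw [hb0] at hz
      refine ⟨?_, hb0⟩
      simpa using hz
    have hs' : ∑ j ∈ Finset.range J, (a (j+1) + b (j+1) * f ^ (t + 1)) * X ^ (R * j) = 0 := by
      rw [Finset.sum_range_succ'] at hs
      rw [key.1, key.2] at hs
      simp only [zero_mul, add_zero] at hs
      have : (∑ j ∈ Finset.range J, (a (j+1) + b (j+1) * f ^ (t + 1)) * X ^ (R * j)) * X ^ R = 0 := by
        rw [Finset.sum_mul, ← hs]
        refine Finset.sum_congr rfl fun j _ => ?_
        ring
      exact (mul_eq_zero.1 this).resolve_right (pow_ne_zero _ X_ne_zero)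
    have := ih (fun j => a (j + 1)) (fun j => b (j + 1)) (fun j => ha _) (fun j => hb _) hs'
    intro j hj
    rcases j with _ | j
    · exact key
    · exact this j (by omega)

lemma stepanov_half {K : Type} [Field K] [Fintype K] (p h : ℕ) [Fact p.Prime] [CharP K p] (f : K[X])
    (t : ℕ) (hR : p ^ h = 2 * t + 1) (hcard : Fintype.card K = (p ^ h) ^ 2)
    (hns : ∀ (c : K) (a b : K[X]), c ≠ 0 → C c * f * b ^ 2 = a ^ 2 → b = 0)
    (h0 : f.eval 0 ≠ 0) (hm : 1 ≤ f.natDegree) (ht : 2 * f.natDegree ≤ t) (eps : K) :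
    (Finset.univ.filter fun x : K => f.eval x ^ (Fintype.card K / 2) = eps).card ≤
      2 * t ^ 2 + 3 * f.natDegree * t + f.natDegree := by
  set m := f.natDegree with hmdef
  obtain ⟨u, hu⟩ := Nat.exists_eq_add_of_le (show m ≤ t by omega)
  obtain ⟨α, hα0, hα⟩ := stepanov_ker f (p ^ h) (t + m) u (t + 1) eps (by omega) (by
    rw [← hmdef, hR, hu]
    nlinarith)
  have hpow : ∀ x : K, x ^ (p ^ h) ^ 2 = x := fun x => by rw [← hcard]; exact FiniteField.pow_card x
  -- the polynomials
  let P : Fin 2 → ℕ → K[X] := fun k j => if hj : j < t + m then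
    ∑ i : Fin (u + 1), C ((α k ⟨j, hj⟩ i) ^ (p ^ h)) * X ^ (i : ℕ) else 0
  have hPdeg : ∀ k j, (P k j).natDegree ≤ u := by
    intro k j
    simp only [P]
    split_ifs with hj
    · refine natDegree_sum_le_of_forall_le _ _ fun i _ => ?_
      refine (natDegree_C_mul_X_pow_le _ _).trans (by omega)
    · simp
  have hPj : ∀ k (j : Fin (t + m)), P k j = ∑ i : Fin (u + 1), C ((α k j i) ^ (p ^ h)) * X ^ (i : ℕ) := by
    intro k j
    simp [P]
  let H : K[X] := ∑ j ∈ Finset.range (t + m), (P 0 j + P 1 j * f ^ (t + 1)) * X ^ (p ^ h * j)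
  have hH0 : H ≠ 0 := by
    intro hH
    have := stepanov_nonvanish p h f t hR hns h0 u (by omega) (t + m) (P 0) (P 1) (hPdeg 0) (hPdeg 1) hH
    apply hα0
    have hk : ∀ k, ∀ j : Fin (t + m), P k j = 0 := by
      intro k j
      fin_cases k
      · exact (this j j.2).1
      · exact (this j j.2).2
    funext k j i
    have h1 := congrArg (fun g : K[X] => g.coeff (i : ℕ)) (hk k j)
    rw [hPj] at h1
    simp only [finsetSum_coeff, coeff_C_mul, coeff_X_pow, coeff_zero] at h1
    rw [Finset.sum_eq_single i] at h1
    · simp only [if_true, mul_one] at h1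
      exact eq_zero_of_pow_eq_zero h1
    · intro b _ hb
      rw [if_neg (fun hh => hb (Fin.ext hh.symm)), mul_zero]
    · simp
  have hHdeg : H.natDegree ≤ 2 * t ^ 2 + 3 * m * t + m := by
    refine natDegree_sum_le_of_forall_le _ _ fun j hj => ?_
    refine natDegree_mul_le.trans ?_
    have h1 : (P 0 j + P 1 j * f ^ (t + 1)).natDegree ≤ u + m * (t + 1) := by
      refine (natDegree_add_le _ _).trans (max_le ((hPdeg _ _).trans (by omega)) ?_)
      refine natDegree_mul_le.trans (Nat.add_le_add (hPdeg _ _) ?_)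
      exact natDegree_pow_le.trans (by rw [mul_comm])
    rw [natDegree_X_pow]
    have h2 := Finset.mem_range.1 hj
    have h3 : p ^ h * j ≤ (2 * t + 1) * (t + m - 1) := by
      rw [hR]; exact Nat.mul_le_mul_left _ (by omega)
    obtain ⟨w, hw⟩ : ∃ w, t + m = w + 1 := ⟨t + m - 1, by omega⟩
    rw [hw] at h3
    simp only [Nat.add_sub_cancel] at h3
    have : w = t + m - 1 := by omega
    have hwt : w + 1 = t + m := hw.symm
    zify at *
    nlinarith
  have hroot : ∀ x : K, f.eval x ^ (Fintype.card K / 2) = eps → H.eval x = 0 := by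
    intro x hx
    have hdiv : Fintype.card K / 2 + (t + 1) = (t + 1) * p ^ h := by
      rw [hcard, hR]
      have : (2 * t + 1) ^ 2 = 2 * (2 * t ^ 2 + 2 * t) + 1 := by ring
      rw [this]
      have : (2 * (2 * t ^ 2 + 2 * t) + 1) / 2 = 2 * t ^ 2 + 2 * t := by omega
      rw [this]; ring
    have hPe : ∀ k (j : Fin (t + m)), (P k j).eval x ^ (p ^ h) = (∑ i : Fin (u + 1), C (α k j i) * X ^ (p ^ h * (i : ℕ))).eval x := by
      intro k j
      rw [hPj, eval_finsetSum, eval_finsetSum, sum_pow_char_pow]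
      refine Finset.sum_congr rfl fun i _ => ?_
      simp only [eval_mul, eval_C, eval_pow, eval_X]
      rw [mul_pow, ← pow_mul, ← sq, hpow, ← pow_mul, mul_comm (i : ℕ)]
    have hz : H.eval x ^ (p ^ h) = 0 := by
      simp only [H]
      rw [Finset.sum_range, eval_finsetSum, sum_pow_char_pow]
      have := congrArg (eval x) hα
      rw [eval_finsetSum, eval_zero] at this
      rw [← this]
      refine Finset.sum_congr rfl fun j _ => ?_
      simp only [eval_mul, eval_add, eval_pow, eval_X, eval_C]
      rw [mul_pow, add_pow_char_pow, mul_pow, hPe, hPe, ← pow_mul, ← hdiv, pow_add, hx]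
      have : (x ^ (p ^ h * (j : ℕ))) ^ p ^ h = x ^ (j : ℕ) := by
        rw [← pow_mul, mul_right_comm, ← sq, pow_mul, hpow]
      rw [this]
      ring
    exact eq_zero_of_pow_eq_zero hz
  calc _ ≤ H.roots.toFinset.card := by
        refine Finset.card_le_card fun x hx => ?_
        rw [Finset.mem_filter] at hx
        rw [Multiset.mem_toFinset, mem_roots hH0]
        exact hroot x hx.2
    _ ≤ H.roots.card := Multiset.toFinset_card_le _
    _ ≤ H.natDegree := card_roots' _
    _ ≤ _ := hHdeg

lemma weil_aux0 {K : Type} [Field K] [Fintype K] (p h : ℕ) [Fact p.Prime] [CharP K p] (f : K[X])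
    (t : ℕ) (hR : p ^ h = 2 * t + 1) (hcard : Fintype.card K = (p ^ h) ^ 2)
    (hns : ∀ (c : K) (a b : K[X]), c ≠ 0 → C c * f * b ^ 2 = a ^ 2 → b = 0)
    (h0 : f.eval 0 ≠ 0) (hm : 1 ≤ f.natDegree) (ht : 2 * f.natDegree ≤ t) :
    |∑ x : K, quadraticChar K (f.eval x)| ≤ 3 * f.natDegree * (p ^ h : ℕ) := by
  have hchar : ringChar K ≠ 2 := by
    intro h2
    have := FiniteField.even_card_of_char_two h2
    rw [hcard, hR] at this
    have h3 : (2 * t + 1) ^ 2 = 2 * (2 * t ^ 2 + 2 * t) + 1 := by ring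
    omega
  have hN := fun eps => stepanov_half p h f t hR hcard hns h0 hm ht eps
  set m := f.natDegree with hmdef
  have hf0 : f ≠ 0 := by rintro rfl; simp at h0
  have hval : ∀ x : K, quadraticChar K (f.eval x) =
      (if f.eval x ^ (Fintype.card K / 2) = 1 then 1 else 0) -
      (if f.eval x ^ (Fintype.card K / 2) = -1 then 1 else 0) := by
    intro x
    by_cases hx : f.eval x = 0
    · rw [hx]
      have : Fintype.card K / 2 ≠ 0 := by have := Fintype.one_lt_card (α := K); omega
      rw [zero_pow this]
      simp
    · have h1 := quadraticChar_eq_pow_of_char_ne_two hchar hx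
      have hne : (-1 : K) ≠ 1 := Ring.neg_one_ne_one_of_char_ne_two hchar
      rcases FiniteField.pow_dichotomy hchar hx with h2 | h2
      · rw [h1, h2]; simp [hne.symm]
      · rw [h1, h2]; simp [hne]
  have hsum : ∑ x : K, quadraticChar K (f.eval x) =
      ((Finset.univ.filter fun x : K => f.eval x ^ (Fintype.card K / 2) = 1).card : ℤ) -
      ((Finset.univ.filter fun x : K => f.eval x ^ (Fintype.card K / 2) = -1).card : ℤ) := by
    rw [Finset.sum_congr rfl (fun x _ => hval x), Finset.sum_sub_distrib]
    simp
  have htot : (Fintype.card K : ℤ) ≤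
      ((Finset.univ.filter fun x : K => f.eval x ^ (Fintype.card K / 2) = 1).card : ℤ) +
      ((Finset.univ.filter fun x : K => f.eval x ^ (Fintype.card K / 2) = -1).card : ℤ) + m := by
    have hz : (Finset.univ.filter fun x : K => f.eval x = 0).card ≤ m := by
      calc _ ≤ f.roots.toFinset.card := by
            refine Finset.card_le_card fun x hx => ?_
            rw [Finset.mem_filter] at hx
            rw [Multiset.mem_toFinset, mem_roots hf0]
            exact hx.2
        _ ≤ f.roots.card := Multiset.toFinset_card_le _
        _ ≤ _ := card_roots' _
    have hsub : (Finset.univ : Finset K) ⊆ ((Finset.univ.filter fun x : K => f.eval x ^ (Fintype.card K / 2) = 1) ∪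
      (Finset.univ.filter fun x : K => f.eval x ^ (Fintype.card K / 2) = -1)) ∪ (Finset.univ.filter fun x : K => f.eval x = 0) := by
      intro x _
      simp only [Finset.mem_union, Finset.mem_filter, Finset.mem_univ, true_and]
      by_cases hx : f.eval x = 0
      · exact Or.inr hx
      · exact Or.inl (FiniteField.pow_dichotomy hchar hx)
    have h1 := Finset.card_le_card hsub
    have h2 := Finset.card_union_le ((Finset.univ.filter fun x : K => f.eval x ^ (Fintype.card K / 2) = 1) ∪
      (Finset.univ.filter fun x : K => f.eval x ^ (Fintype.card K / 2) = -1)) (Finset.univ.filter fun x : K => f.eval x = 0)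
    have h3 := Finset.card_union_le (Finset.univ.filter fun x : K => f.eval x ^ (Fintype.card K / 2) = 1)
      (Finset.univ.filter fun x : K => f.eval x ^ (Fintype.card K / 2) = -1)
    rw [Finset.card_univ] at h1
    have h4 := h1.trans (h2.trans (Nat.add_le_add h3 hz))
    have h5 := (Nat.cast_le (α := ℤ)).2 h4
    rw [Nat.cast_add, Nat.cast_add] at h5
    exact h5
  have hp1 := hN 1
  have hp2 := hN (-1)
  rw [hsum, abs_le]
  rw [hcard] at htot hp1 hp2 ⊢
  generalize (Finset.univ.filter fun x : K => f.eval x ^ ((p ^ h) ^ 2 / 2) = 1).card = N1 at *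
  generalize (Finset.univ.filter fun x : K => f.eval x ^ ((p ^ h) ^ 2 / 2) = -1).card = N2 at *
  rw [hR] at htot ⊢
  zify at hp1 hp2
  push_cast at *
  constructor <;> nlinarith

lemma weil_aux {K : Type} [Field K] [Fintype K] (p h : ℕ) [Fact p.Prime] [CharP K p] (f : K[X])
    (t : ℕ) (hR : p ^ h = 2 * t + 1) (hcard : Fintype.card K = (p ^ h) ^ 2)
    (hns : ∀ (c : K) (a b : K[X]), c ≠ 0 → C c * f * b ^ 2 = a ^ 2 → b = 0)
    (hm : 1 ≤ f.natDegree) (ht : 2 * f.natDegree ≤ t) :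
    |∑ x : K, quadraticChar K (f.eval x)| ≤ 3 * f.natDegree * (p ^ h : ℕ) := by
  have hf0 : f ≠ 0 := by rintro rfl; simp at hm
  obtain ⟨z, hz⟩ : ∃ z : K, f.eval z ≠ 0 := by
    by_contra hcon
    push Not at hcon
    have h1 : Fintype.card K ≤ f.natDegree := by
      calc Fintype.card K = (Finset.univ : Finset K).card := rfl
        _ ≤ f.roots.toFinset.card := by
            refine Finset.card_le_card fun x hx => ?_
            rw [Multiset.mem_toFinset, mem_roots hf0]
            exact hcon x
        _ ≤ f.roots.card := Multiset.toFinset_card_le _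
        _ ≤ _ := card_roots' _
    rw [hcard, hR] at h1
    nlinarith
  have hdeg : (f.comp (X + C z)).natDegree = f.natDegree := by
    rw [natDegree_comp, natDegree_X_add_C, mul_one]
  have := weil_aux0 p h (f.comp (X + C z)) t hR hcard (by
    intro c a b hc hab
    have h1 := congrArg (fun g : K[X] => g.comp (X - C z)) hab
    simp only [mul_comp, pow_comp, C_comp, comp_assoc, add_comp, X_comp, sub_add_cancel, comp_X] at h1
    have h2 := hns c _ _ hc h1
    have h3 := congrArg (fun g : K[X] => g.comp (X + C z)) h2
    simpa [comp_assoc] using h3) (by simpa using hz) (by rw [hdeg]; exact hm) (by rw [hdeg]; exact ht)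
  rw [hdeg] at this
  have h2 := Equiv.sum_comp (Equiv.addRight z) (fun x : K => quadraticChar K (f.eval x))
  rw [← h2]
  simpa using this

lemma two_dvd_card_sub_one (hodd : Odd (Fintype.card F)) : ringChar F ≠ 2 := by
  intro h2
  have := FiniteField.even_card_of_char_two h2
  rw [Nat.odd_iff] at hodd
  omega

lemma quadraticChar_norm (hodd : Odd (Fintype.card F)) (K : Type) [Field K] [Fintype K] [Algebra F K] (y : K) :
    quadraticChar K y = quadraticChar F (Algebra.norm F y) := by
  have hF : ringChar F ≠ 2 := two_dvd_card_sub_one F hodd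
  have hK : ringChar K ≠ 2 := by rwa [← Algebra.ringChar_eq F K]
  by_cases hy : y = 0
  · subst hy
    rw [Algebra.norm_zero, MulChar.map_zero, MulChar.map_zero]
  have hn : Algebra.norm F y ≠ 0 := Algebra.norm_ne_zero_iff.2 hy
  rw [quadraticChar_eq_pow_of_char_ne_two hK hy, quadraticChar_eq_pow_of_char_ne_two hF hn]
  have hcard : Fintype.card K = Fintype.card F ^ Module.finrank F K := Module.card_eq_pow_finrank
  have key : y ^ (Fintype.card K / 2) = 1 ↔ Algebra.norm F y ^ (Fintype.card F / 2) = 1 := by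
    rw [← (algebraMap F K).injective.eq_iff, map_pow, FiniteField.algebraMap_norm_eq_pow, map_one,
      ← pow_mul, Nat.card_eq_fintype_card, Nat.card_eq_fintype_card]
    have h1 : (Fintype.card K - 1) / (Fintype.card F - 1) * (Fintype.card F / 2) = Fintype.card K / 2 := by
      have hdvd : Fintype.card F - 1 ∣ Fintype.card K - 1 := by
        rw [hcard]; simpa using Nat.sub_dvd_pow_sub_pow (Fintype.card F) 1 (Module.finrank F K)
      have hoddK : Odd (Fintype.card K) := by rw [hcard]; exact hodd.pow
      obtain ⟨a, ha⟩ := hodd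
      obtain ⟨b, hb⟩ := hoddK
      obtain ⟨c, hc⟩ := hdvd
      have hF1 := Fintype.one_lt_card (α := F)
      rw [hc, Nat.mul_div_cancel_left _ (by omega)]
      have : Fintype.card F - 1 = 2 * a := by omega
      rw [this] at hc
      have h3 : Fintype.card F / 2 = a := by omega
      have h4 : Fintype.card K / 2 = b := by omega
      rw [h3, h4]
      have : 2 * b = 2 * a * c := by omega
      nlinarith
    rw [h1]
  simp only [key]

lemma norm_aeval_gen (K : Type) [Field K] [Finite K] [Algebra F K] (pb : PowerBasis F K) (a : F[X]) :
    Algebra.norm F (aeval pb.gen a) = resultant (minpoly F pb.gen) a := by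
  have : FiniteDimensional F K := pb.finite
  let E := AlgebraicClosure F
  apply (algebraMap F E).injective
  rw [Algebra.norm_eq_prod_embeddings F E, ← resultant_map_map]
  have hint : IsIntegral F pb.gen := Algebra.IsIntegral.isIntegral _
  have hmon := minpoly.monic hint
  have h1 := resultant_eq_prod_eval ((minpoly F pb.gen).map (algebraMap F E)) (a.map (algebraMap F E)) a.natDegree
    natDegree_map_le (IsAlgClosed.splits _)
  rw [natDegree_map] at h1
  rw [h1, (hmon.map _).leadingCoeff, one_pow, one_mul]
  have hsep : (minpoly F pb.gen).Separable := Algebra.IsSeparable.isSeparable F pb.gen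
  rw [Fintype.prod_equiv pb.liftEquiv' (fun σ : K →ₐ[F] E => σ (aeval pb.gen a))
    (fun x => (a.map (algebraMap F E)).eval (x : E))]
  · rw [Finset.prod_mem_multiset _ _ (g := fun x => (a.map (algebraMap F E)).eval x), Finset.prod_eq_multiset_prod, Multiset.toFinset_val,
      Multiset.dedup_eq_self.mpr]
    · exact nodup_roots (.map hsep)
    · intro x; rfl
  · intro σ
    rw [PowerBasis.liftEquiv'_apply_coe, eval_map_algebraMap, aeval_algHom_apply]

lemma finite_adjoinRoot (p : F[X]) (hp : p ≠ 0) : Finite (AdjoinRoot p) := by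
  have : Module.Finite F (AdjoinRoot p) := (AdjoinRoot.powerBasis hp).finite
  exact Module.finite_of_finite F

lemma legP_eq_char (hodd : Odd (Fintype.card F)) (p : F[X]) [Fact (Irreducible p)] [Fintype (AdjoinRoot p)] (a : F[X]) :
    legP F a p = quadraticChar (AdjoinRoot p) (AdjoinRoot.mk p a) := by
  unfold legP
  rw [quadraticChar_apply, quadraticCharFun]
  simp only [AdjoinRoot.mk_eq_zero]
  split_ifs with h1 h2 h3 h3
  · rfl
  · rfl
  · exfalso
    apply h3
    obtain ⟨b, hb⟩ := h2
    refine ⟨AdjoinRoot.mk p b, ?_⟩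
    rw [← map_mul, eq_comm, AdjoinRoot.mk_eq_mk]
    rw [← sq]; exact hb
  · exfalso
    apply h2
    obtain ⟨y, hy⟩ := h3
    obtain ⟨b, rfl⟩ := AdjoinRoot.mk_surjective y
    refine ⟨b, ?_⟩
    rw [← map_mul, eq_comm, AdjoinRoot.mk_eq_mk, ← sq] at hy
    exact hy
  · rfl

lemma legP_eq_res (hodd : Odd (Fintype.card F)) (p : F[X]) (hp : Irreducible p) (hm : p.Monic) (a : F[X]) :
    legP F a p = quadraticChar F (resultant p a) := by
  have : Fact (Irreducible p) := ⟨hp⟩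
  have := finite_adjoinRoot F p hp.ne_zero
  let _ : Fintype (AdjoinRoot p) := Fintype.ofFinite _
  rw [legP_eq_char F hodd, quadraticChar_norm F hodd]
  congr 1
  have h1 := norm_aeval_gen F (AdjoinRoot p) (AdjoinRoot.powerBasis hp.ne_zero) a
  rw [AdjoinRoot.powerBasis_gen, AdjoinRoot.minpoly_root hp.ne_zero, hm.leadingCoeff, inv_one, C_1, mul_one,
    AdjoinRoot.aeval_eq] at h1
  exact h1

lemma legP_mul (hodd : Odd (Fintype.card F)) (p : F[X]) (hp : Irreducible p) (a b : F[X]) :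
    legP F (a * b) p = legP F a p * legP F b p := by
  have : Fact (Irreducible p) := ⟨hp⟩
  have := finite_adjoinRoot F p hp.ne_zero
  let _ : Fintype (AdjoinRoot p) := Fintype.ofFinite _
  rw [legP_eq_char F hodd, legP_eq_char F hodd, legP_eq_char F hodd, map_mul, map_mul]

lemma legP_congr (hodd : Odd (Fintype.card F)) (p : F[X]) (hp : Irreducible p) (a b : F[X]) (hab : p ∣ a - b) :
    legP F a p = legP F b p := by
  have : Fact (Irreducible p) := ⟨hp⟩
  have := finite_adjoinRoot F p hp.ne_zero
  let _ : Fintype (AdjoinRoot p) := Fintype.ofFinite _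
  rw [legP_eq_char F hodd, legP_eq_char F hodd, AdjoinRoot.mk_eq_mk.2 hab]

lemma legP_nonres (hodd : Odd (Fintype.card F)) (p : F[X]) (hp : Irreducible p) :
    ∃ a, legP F a p = -1 := by
  have : Fact (Irreducible p) := ⟨hp⟩
  have := finite_adjoinRoot F p hp.ne_zero
  let _ : Fintype (AdjoinRoot p) := Fintype.ofFinite _
  have hK : ringChar (AdjoinRoot p) ≠ 2 := by
    rw [← Algebra.ringChar_eq F (AdjoinRoot p)]; exact two_dvd_card_sub_one F hodd
  obtain ⟨y, hy⟩ := quadraticChar_exists_neg_one hK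
  obtain ⟨b, rfl⟩ := AdjoinRoot.mk_surjective y
  exact ⟨b, by rw [legP_eq_char F hodd, hy]⟩

lemma legP_one (p : F[X]) (hp : Irreducible p) : legP F 1 p = 1 := by
  unfold legP
  rw [if_neg (fun h => hp.not_isUnit (isUnit_of_dvd_one h)), if_pos ⟨1, by simp⟩]

lemma mem_nf {m p : F[X]} (hm : m ≠ 0) : p ∈ normalizedFactors m ↔ Irreducible p ∧ p.Monic ∧ p ∣ m := by
  rw [mem_normalizedFactors_iff' hm]
  constructor
  · rintro ⟨h1, h2, h3⟩
    refine ⟨h1, ?_, h3⟩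
    rw [← h2]; exact monic_normalize h1.ne_zero
  · rintro ⟨h1, h2, h3⟩
    exact ⟨h1, h2.normalize_eq_self, h3⟩

lemma prod_nf {m : F[X]} (hm : m.Monic) : (normalizedFactors m).prod = m := by
  rw [prod_normalizedFactors_eq hm.ne_zero, hm.normalize_eq_self]

lemma chi_eq_res (hodd : Odd (Fintype.card F)) (m : F[X]) (hm : m.Monic) (a : F[X]) :
    chi F a m = quadraticChar F (resultant m a) := by
  have key : ∀ s : Multiset F[X], (∀ p ∈ s, Irreducible p ∧ p.Monic) →
      (s.map (legP F a)).prod = quadraticChar F (resultant s.prod a) := by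
    intro s
    induction s using Multiset.induction_on with
    | empty => intro _; simp
    | cons p s ih =>
      intro hs
      have h1 := hs p (Multiset.mem_cons_self _ _)
      have h2 : ∀ q ∈ s, Irreducible q ∧ q.Monic := fun q hq => hs q (Multiset.mem_cons_of_mem hq)
      have h3 : s.prod.Monic := by
        simpa using monic_multiset_prod_of_monic s id (fun q hq => (h2 q hq).2)
      rw [Multiset.map_cons, Multiset.prod_cons, Multiset.prod_cons, ih h2, legP_eq_res F hodd p h1.1 h1.2,
        ← map_mul, h1.2.natDegree_mul h3, resultant_mul_left _ _ _ _ le_rfl]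
  rw [chi, key _ (fun p hp => ?_), prod_nf F hm]
  have := (mem_nf F hm.ne_zero).1 hp
  exact ⟨this.1, this.2.1⟩

lemma chi_mul (hodd : Odd (Fintype.card F)) (m : F[X]) (hm : m.Monic) (a b : F[X]) :
    chi F (a * b) m = chi F a m * chi F b m := by
  rw [chi, chi, chi, ← Multiset.prod_map_mul]
  congr 1
  refine Multiset.map_congr rfl fun p hp => ?_
  exact legP_mul F hodd p ((mem_nf F hm.ne_zero).1 hp).1 a b

lemma chi_congr (hodd : Odd (Fintype.card F)) (m : F[X]) (hm : m.Monic) (a b : F[X]) (hab : m ∣ a - b) :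
    chi F a m = chi F b m := by
  rw [chi, chi]
  congr 1
  refine Multiset.map_congr rfl fun p hp => ?_
  have := (mem_nf F hm.ne_zero).1 hp
  exact legP_congr F hodd p this.1 a b (this.2.2.trans hab)

lemma chi_mul_right (a m n : F[X]) (hm : m.Monic) (hn : n.Monic) :
    chi F a (m * n) = chi F a m * chi F a n := by
  rw [chi, chi, chi, normalizedFactors_mul hm.ne_zero hn.ne_zero, Multiset.map_add, Multiset.prod_add]

lemma chi_one_right (a : F[X]) : chi F a 1 = 1 := by
  simp [chi]

lemma chi_one_left (m : F[X]) (hm : m.Monic) : chi F 1 m = 1 := by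
  rw [chi]
  apply Multiset.prod_eq_one
  intro x hx
  obtain ⟨p, hp, rfl⟩ := Multiset.mem_map.1 hx
  exact legP_one F p ((mem_nf F hm.ne_zero).1 hp).1

lemma chi_prod {ι : Type} (s : Finset ι) (a : F[X]) (f : ι → F[X]) (hf : ∀ i, (f i).Monic) :
    ∏ i ∈ s, chi F a (f i) = chi F a (∏ i ∈ s, f i) := by
  induction s using Finset.induction_on with
  | empty => simp [chi_one_right]
  | insert i s hi ih =>
    rw [Finset.prod_insert hi, Finset.prod_insert hi, ih, chi_mul_right F _ _ _ (hf i) (monic_prod_of_monic _ _ fun j _ => hf j)]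

lemma legP_sq (a p : F[X]) : legP F a p * legP F a p = if p ∣ a then 0 else 1 := by
  unfold legP
  split_ifs <;> simp

lemma chi_sq (a m : F[X]) (hm : m.Monic) :
    chi F a m * chi F a m = if ∃ p ∈ normalizedFactors m, p ∣ a then 0 else 1 := by
  rw [chi, ← Multiset.prod_map_mul]
  split_ifs with h
  · obtain ⟨p, hp, hpa⟩ := h
    apply Multiset.prod_eq_zero
    rw [Multiset.mem_map]
    exact ⟨p, hp, by rw [legP_sq, if_pos hpa]⟩
  · push Not at h
    apply Multiset.prod_eq_one
    intro x hx
    obtain ⟨p, hp, rfl⟩ := Multiset.mem_map.1 hx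
    rw [legP_sq, if_neg (h p hp)]

lemma char_eval_eq (hodd : Odd (Fintype.card F)) (K : Type) [Field K] [Fintype K] [Algebra F K]
    (heven : Even (Module.finrank F K)) (m : F[X]) (hm : m.Monic) (x : K) (i : ℕ)
    (hi : (minpoly F x).natDegree * i = Module.finrank F K) :
    quadraticChar K (aeval x m) = chi F (minpoly F x) m ^ i := by
  have hint : IsIntegral F x := Algebra.IsIntegral.isIntegral _
  rw [quadraticChar_norm F hodd, chi_eq_res F hodd m hm, ← map_pow]
  let L := IntermediateField.adjoin F {x}
  let pb := IntermediateField.adjoin.powerBasis hint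
  have hgen : pb.gen = IntermediateField.AdjoinSimple.gen F x := IntermediateField.adjoin.powerBasis_gen hint
  have hmin : minpoly F pb.gen = minpoly F x := by rw [hgen]; exact IntermediateField.minpoly_gen F x
  have h1 : aeval x m = algebraMap L K (aeval pb.gen m) := by
    rw [← aeval_algebraMap_apply, hgen, IntermediateField.AdjoinSimple.algebraMap_gen]
  have hfr : Module.finrank L K = i := by
    have h2 := Module.finrank_mul_finrank F L K
    rw [IntermediateField.adjoin.finrank hint, ← hi] at h2
    exact Nat.eq_of_mul_eq_mul_left (minpoly.natDegree_pos hint) h2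
  have h3 : Algebra.norm F (aeval x m) = resultant (minpoly F x) m ^ i := by
    rw [h1, ← Algebra.norm_norm (S := L), Algebra.norm_algebraMap, hfr, map_pow, norm_aeval_gen F L pb, hmin]
  rw [h3, resultant_comm, mul_pow, map_mul, ← pow_mul, mul_right_comm, hi]
  have : (-1 : F) ^ (Module.finrank F K * m.natDegree) = 1 := (heven.mul_right _).neg_one_pow
  rw [this]
  simp

/-- Finset of monic polynomials of degree `n`. -/
def mon (n : ℕ) : Finset F[X] :=
  ((finite_natDegree_le F n).subset (fun m (hm : m ∈ {m : F[X] | m.Monic ∧ m.natDegree = n}) => le_of_eq hm.2)).toFinset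

lemma mem_mon {n : ℕ} {m : F[X]} : m ∈ mon F n ↔ m.Monic ∧ m.natDegree = n := by
  simp [mon]

/-- Finset of monic squarefree polynomials of degree `n`. -/
def sfs (n : ℕ) : Finset F[X] := (mon F n).filter Squarefree

lemma mem_sfs {n : ℕ} {m : F[X]} : m ∈ sfs F n ↔ (m.Monic ∧ m.natDegree = n) ∧ Squarefree m := by
  rw [sfs, Finset.mem_filter, mem_mon]

lemma card_mon (n : ℕ) : (mon F n).card = Fintype.card F ^ n := by
  have h1 : (mon F n).card = Nat.card {p : F[X] // p.Monic ∧ p.natDegree = n} := by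
    rw [← Nat.card_eq_finsetCard]
    exact Nat.card_congr (Equiv.subtypeEquivRight fun x => mem_mon F)
  rw [h1, Nat.card_congr (monicEquivDegreeLT n), Nat.card_congr (degreeLTEquiv F n).toEquiv]
  simp

lemma exists_odd_prime (m : F[X]) (hm : m.Monic) (hns : ¬ ∃ v : F[X], v.Monic ∧ m = v ^ 2) :
    ∃ (p : F[X]) (k : ℕ) (m' : F[X]), Irreducible p ∧ p.Monic ∧ m'.Monic ∧ Odd k ∧ m = p ^ k * m' ∧ ¬ p ∣ m' := by
  have h1 : ∃ p ∈ normalizedFactors m, Odd ((normalizedFactors m).count p) := by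
    by_contra hcon
    push Not at hcon
    apply hns
    let s : Multiset F[X] := ∑ p ∈ (normalizedFactors m).toFinset, ((normalizedFactors m).count p / 2) • {p}
    have hs : normalizedFactors m = s + s := by
      ext a
      rw [Multiset.count_add]
      simp only [s, Multiset.count_sum', Multiset.count_nsmul, Multiset.count_singleton]
      by_cases ha : a ∈ normalizedFactors m
      · rw [Finset.sum_eq_single a]
        · have := hcon a ha
          rw [Nat.not_odd_iff_even] at this
          obtain ⟨r, hr⟩ := this
          simp; omega
        · intro b _ hb; simp [hb.symm]
        · intro h; exact absurd (Multiset.mem_toFinset.2 ha) h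
      · symm
        rw [Multiset.count_eq_zero_of_notMem ha]
        have hz : ∀ b ∈ (normalizedFactors m).toFinset, ((normalizedFactors m).count b / 2 * if a = b then 1 else 0) = 0 := by
          intro b hb
          have : a ≠ b := by rintro rfl; exact ha (Multiset.mem_toFinset.1 hb)
          simp [this]
        rw [Finset.sum_eq_zero hz, add_zero]
    refine ⟨s.prod, ?_, ?_⟩
    · have : ∀ p ∈ s, p.Monic := by
        intro p hp
        have : p ∈ normalizedFactors m := by rw [hs]; exact Multiset.mem_add.2 (Or.inl hp)
        exact ((mem_nf F hm.ne_zero).1 this).2.1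
      simpa using monic_multiset_prod_of_monic s id this
    · rw [sq, ← Multiset.prod_add, ← hs, prod_nf F hm]
  obtain ⟨p, hp, hodd⟩ := h1
  obtain ⟨hpi, hpm, hpd⟩ := (mem_nf F hm.ne_zero).1 hp
  have hf : FiniteMultiplicity p m := FiniteMultiplicity.of_not_isUnit hpi.not_isUnit hm.ne_zero
  obtain ⟨m', hm', hnd⟩ := hf.exists_eq_pow_mul_and_not_dvd
  refine ⟨p, multiplicity p m, m', hpi, hpm, ?_, ?_, hm', hnd⟩
  · have h := hm
    rw [hm'] at h
    exact (hpm.pow _).of_mul_monic_left h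
  · have := count_normalizedFactors_eq (p := p) (x := m) (n := multiplicity p m) hpi hpm.normalize_eq_self
      (pow_multiplicity_dvd _ _) (hf.not_pow_dvd_of_multiplicity_lt (Nat.lt_succ_self _))
    rwa [this] at hodd

lemma chi_pow_right (a p : F[X]) (hp : p.Monic) (k : ℕ) : chi F a (p ^ k) = chi F a p ^ k := by
  induction k with
  | zero => simp [chi_one_right]
  | succ k ih => rw [pow_succ, chi_mul_right F _ _ _ (hp.pow _) hp, ih, pow_succ]

lemma chi_irr (a p : F[X]) (hp : p.Monic) (hi : Irreducible p) : chi F a p = legP F a p := by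
  rw [chi, normalizedFactors_irreducible hi, hp.normalize_eq_self]
  simp

lemma exists_chi_neg (hodd : Odd (Fintype.card F)) (m : F[X]) (hm : m.Monic) (hns : ¬ ∃ v : F[X], v.Monic ∧ m = v ^ 2) :
    ∃ a, chi F a m = -1 := by
  obtain ⟨p, k, m', hpi, hpm, hm', hk, rfl, hnd⟩ := exists_odd_prime F m hm hns
  obtain ⟨a0, ha0⟩ := legP_nonres F hodd p hpi
  obtain ⟨u, v, huv⟩ := (hpi.coprime_iff_not_dvd.2 hnd)
  refine ⟨a0 * (v * m') + u * p, ?_⟩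
  rw [chi_mul_right F _ _ _ (hpm.pow _) hm', chi_pow_right F _ _ hpm, chi_irr F _ _ hpm hpi]
  rw [legP_congr F hodd p hpi _ a0, ha0, chi_congr F hodd m' hm' _ 1, chi_one_left F m' hm', hk.neg_one_pow, mul_one]
  · refine ⟨a0 * v - v, ?_⟩
    rw [← huv]; ring
  · refine ⟨u - a0 * u, ?_⟩
    have : v * m' = 1 - u * p := by rw [← huv]; ring
    rw [this]; ring

lemma coprime_of_chi_ne_zero (m a : F[X]) (hm : m.Monic) (h : chi F a m ≠ 0) : IsCoprime a m := by
  refine isCoprime_of_prime_dvd (fun h0 => hm.ne_zero h0.2) fun p hp hpa hpm => ?_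
  apply h
  have hnp : normalize p ∈ normalizedFactors m := by
    rw [mem_nf F hm.ne_zero]
    exact ⟨(normalize_associated p).symm.irreducible hp.irreducible, monic_normalize hp.ne_zero, normalize_dvd_iff.2 hpm⟩
  rw [chi]
  apply Multiset.prod_eq_zero
  rw [Multiset.mem_map]
  refine ⟨_, hnp, ?_⟩
  rw [legP, if_pos (normalize_dvd_iff.2 hpa)]

lemma csum_vanish (hodd : Odd (Fintype.card F)) (m : F[X]) (hm : m.Monic) (hns : ¬ ∃ v : F[X], v.Monic ∧ m = v ^ 2)
    (k : ℕ) (hk : m.natDegree ≤ k) : ∑ e ∈ mon F k, chi F e m = 0 := by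
  obtain ⟨a, ha⟩ := exists_chi_neg F hodd m hm hns
  have hcop : IsCoprime m a := (coprime_of_chi_ne_zero F m a hm (by rw [ha]; norm_num)).symm
  have hm1 : m ≠ 1 := by
    rintro rfl
    exact hns ⟨1, monic_one, by simp⟩
  let φ : F[X] → F[X] := fun e => e - e %ₘ m + (a * e) %ₘ m
  have hφchi : ∀ e, chi F (φ e) m = - chi F e m := by
    intro e
    rw [← neg_one_mul, ← ha, ← chi_mul F hodd m hm]
    apply chi_congr F hodd m hm
    have h1 := modByMonic_add_div e m
    have h2 := modByMonic_add_div (a * e) m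
    refine ⟨e /ₘ m - (a * e) /ₘ m, ?_⟩
    simp only [φ]
    linear_combination h2 - h1
  have hlt : ∀ e : F[X], (e %ₘ m).degree < m.degree := fun e => degree_modByMonic_lt e hm
  have hmem : ∀ e ∈ mon F k, φ e ∈ mon F k := by
    intro e he
    rw [mem_mon] at he ⊢
    have hr : (- (e %ₘ m) + (a * e) %ₘ m).degree < e.degree := by
      refine lt_of_lt_of_le (lt_of_le_of_lt (degree_add_le _ _) (max_lt ?_ (hlt _))) (?_ : m.degree ≤ e.degree)
      · rw [degree_neg]; exact hlt _
      · rw [degree_eq_natDegree hm.ne_zero, degree_eq_natDegree he.1.ne_zero, he.2]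
        exact_mod_cast hk
    have heq : φ e = e + (- (e %ₘ m) + (a * e) %ₘ m) := by simp only [φ]; ring
    rw [heq]
    refine ⟨he.1.add_of_left hr, ?_⟩
    rw [← he.2]
    exact natDegree_eq_of_degree_eq (degree_add_eq_left_of_degree_lt hr)
  have hinj : Set.InjOn φ (mon F k) := by
    intro e he e' he' h
    have h1 := modByMonic_add_div e m
    have h2 := modByMonic_add_div e' m
    have h3 := modByMonic_add_div (a * e) m
    have h4 := modByMonic_add_div (a * e') m
    have hq : e /ₘ m = e' /ₘ m := by
      have hd : m * (e /ₘ m - e' /ₘ m) = (a * e') %ₘ m - (a * e) %ₘ m := by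
        simp only [φ] at h
        linear_combination h + h1 - h2
      have := eq_zero_of_dvd_of_degree_lt (⟨_, hd.symm⟩ : m ∣ (a * e') %ₘ m - (a * e) %ₘ m)
        (lt_of_le_of_lt (degree_sub_le _ _) (max_lt (hlt _) (hlt _)))
      rw [this] at hd
      exact sub_eq_zero.1 ((mul_eq_zero.1 hd).resolve_left hm.ne_zero)
    have hmod : (a * e) %ₘ m = (a * e') %ₘ m := by
      simp only [φ] at h
      rw [hq] at h1
      linear_combination h + h1 - h2
    have hdvd : m ∣ a * (e - e') := by
      rw [hmod] at h3
      exact ⟨(a * e) /ₘ m - (a * e') /ₘ m, by linear_combination h4 - h3⟩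
    have hdvd2 := hcop.dvd_of_dvd_mul_left hdvd
    have hd5 : m ∣ e %ₘ m - e' %ₘ m := by
      refine (dvd_of_eq ?_ : m ∣ m) |>.trans (hdvd2.trans (dvd_of_eq ?_))
      · rfl
      · rw [hq] at h1
        linear_combination h2 - h1
    have := eq_zero_of_dvd_of_degree_lt hd5 (lt_of_le_of_lt (degree_sub_le _ _) (max_lt (hlt _) (hlt _)))
    rw [hq] at h1
    linear_combination h2 - h1 + this
  have himg : (mon F k).image φ = mon F k := by
    apply Finset.eq_of_subset_of_card_le
    · intro x hx
      obtain ⟨e, he, rfl⟩ := Finset.mem_image.1 hx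
      exact hmem e he
    · rw [Finset.card_image_of_injOn hinj]
  have hsum : ∑ e ∈ mon F k, chi F e m = - ∑ e ∈ mon F k, chi F e m := by
    conv_lhs => rw [← himg, Finset.sum_image hinj]
    rw [← Finset.sum_neg_distrib]
    exact Finset.sum_congr rfl fun e _ => hφchi e
  linarith

/-- Monic irreducible polynomials of degree at most `N`. -/
def irrs (N : ℕ) : Finset F[X] := (Finset.Icc 1 N).biUnion fun d => (mon F d).filter Irreducible

lemma mem_irrs {N : ℕ} {p : F[X]} : p ∈ irrs F N ↔ Irreducible p ∧ p.Monic ∧ p.natDegree ≤ N := by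
  simp only [irrs, Finset.mem_biUnion, Finset.mem_filter, mem_mon, Finset.mem_Icc]
  constructor
  · rintro ⟨d, ⟨h1, h2⟩, ⟨h3, h4⟩, h5⟩
    exact ⟨h5, h3, by omega⟩
  · rintro ⟨h1, h2, h3⟩
    exact ⟨p.natDegree, ⟨h1.natDegree_pos, h3⟩, ⟨h2, rfl⟩, h1⟩

/-- Power sums. -/
def Ssum (ψ : F[X] → ℤ) (j : ℕ) : ℤ :=
  ∑ p ∈ irrs F j, ∑ i ∈ Finset.Icc 1 j, if i * p.natDegree = j then (p.natDegree : ℤ) * ψ p ^ i else 0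

lemma Ssum_eq (ψ : F[X] → ℤ) {j k : ℕ} (hj : 1 ≤ j) (hk : j ≤ k) :
    Ssum F ψ j = ∑ p ∈ irrs F k, ∑ i ∈ Finset.Icc 1 k, if i * p.natDegree = j then (p.natDegree : ℤ) * ψ p ^ i else 0 := by
  unfold Ssum
  rw [Finset.sum_subset (s₁ := irrs F j) (s₂ := irrs F k)]
  · refine Finset.sum_congr rfl fun p hp => ?_
    have hp1 := ((mem_irrs F).1 hp).1.natDegree_pos
    apply Finset.sum_subset
    · exact Finset.Icc_subset_Icc_right hk
    · intro i hi hi'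
      rw [if_neg]
      intro h
      apply hi'
      rw [Finset.mem_Icc] at hi ⊢
      refine ⟨hi.1, ?_⟩
      rw [← h]; exact Nat.le_mul_of_pos_right _ hp1
  · intro p hp
    rw [mem_irrs] at hp ⊢
    exact ⟨hp.1, hp.2.1, hp.2.2.trans hk⟩
  · intro p hp hp'
    refine Finset.sum_eq_zero fun i hi => ?_
    rw [if_neg]
    intro h
    rw [mem_irrs] at hp hp'
    apply hp'
    refine ⟨hp.1, hp.2.1, ?_⟩
    rw [← h]; exact Nat.le_mul_of_pos_left _ (Finset.mem_Icc.1 hi).1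

lemma pow_dvd_iff_count {e p : F[X]} (he : e.Monic) (hp : Irreducible p) (hpm : p.Monic) (i : ℕ) :
    p ^ i ∣ e ↔ i ≤ (normalizedFactors e).count p := by
  rw [pow_dvd_iff_le_emultiplicity, emultiplicity_eq_count_normalizedFactors hp he.ne_zero, hpm.normalize_eq_self]
  exact_mod_cast Iff.rfl

lemma deg_eq_sum {k : ℕ} {e : F[X]} (he : e ∈ mon F k) :
    (∑ p ∈ irrs F k, p.natDegree * ∑ i ∈ Finset.Icc 1 k, if p ^ i ∣ e then 1 else 0) = k := by
  obtain ⟨hm, hd⟩ := (mem_mon F).1 he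
  have h1 : ∀ p ∈ irrs F k, (∑ i ∈ Finset.Icc 1 k, if p ^ i ∣ e then 1 else 0) = (normalizedFactors e).count p := by
    intro p hp
    obtain ⟨hp1, hp2, hp3⟩ := (mem_irrs F).1 hp
    rw [← Finset.card_filter]
    have : (Finset.Icc 1 k).filter (fun i => p ^ i ∣ e) = Finset.Icc 1 ((normalizedFactors e).count p) := by
      ext i
      rw [Finset.mem_filter, pow_dvd_iff_count F hm hp1 hp2, Finset.mem_Icc, Finset.mem_Icc]
      constructor
      · rintro ⟨h, h'⟩; exact ⟨h.1, h'⟩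
      · rintro ⟨h, h'⟩
        refine ⟨⟨h, ?_⟩, h'⟩
        have := (pow_dvd_iff_count F hm hp1 hp2 i).2 h'
        have := natDegree_le_of_dvd this hm.ne_zero
        rw [natDegree_pow, hd] at this
        exact le_trans (Nat.le_mul_of_pos_right _ hp1.natDegree_pos) this
    rw [this]; simp
  rw [Finset.sum_congr rfl fun p hp => by rw [h1 p hp]]
  have h2 : (normalizedFactors e).toFinset ⊆ irrs F k := by
    intro p hp
    rw [Multiset.mem_toFinset, mem_nf F hm.ne_zero] at hp
    rw [mem_irrs]
    exact ⟨hp.1, hp.2.1, hd ▸ natDegree_le_of_dvd hp.2.2 hm.ne_zero⟩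
  rw [← Finset.sum_subset h2]
  · have h3 := Finset.sum_multiset_map_count (normalizedFactors e) (fun p : F[X] => p.natDegree)
    have h4 := natDegree_multiset_prod_of_monic (normalizedFactors e) (fun p hp => ((mem_nf F hm.ne_zero).1 hp).2.1)
    rw [prod_nf F hm, hd, h3] at h4
    rw [h4]
    exact Finset.sum_congr rfl fun p _ => by rw [smul_eq_mul, mul_comm]
  · intro p _ hp
    rw [Multiset.mem_toFinset] at hp
    rw [Multiset.count_eq_zero_of_notMem hp, mul_zero]

lemma sum_dvd (w : F[X] → ℤ) {a : F[X]} (ha : a.Monic) (k : ℕ) :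
    (∑ e ∈ mon F k, if a ∣ e then w e else 0) =
      if a.natDegree ≤ k then ∑ b ∈ mon F (k - a.natDegree), w (a * b) else 0 := by
  split_ifs with h
  · rw [← Finset.sum_filter]
    symm
    refine Finset.sum_bij (fun b _ => a * b) ?_ ?_ ?_ ?_
    · intro b hb
      rw [mem_mon] at hb
      rw [Finset.mem_filter, mem_mon]
      refine ⟨⟨ha.mul hb.1, ?_⟩, dvd_mul_right _ _⟩
      rw [ha.natDegree_mul hb.1, hb.2]; omega
    · intro b hb b' hb' hbb
      exact mul_left_cancel₀ ha.ne_zero hbb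
    · intro e he
      rw [Finset.mem_filter, mem_mon] at he
      obtain ⟨⟨h1, h2⟩, b, rfl⟩ := he
      have hb := ha.of_mul_monic_left h1
      refine ⟨b, ?_, rfl⟩
      rw [mem_mon]
      rw [ha.natDegree_mul hb] at h2
      exact ⟨hb, by omega⟩
    · intros; rfl
  · refine Finset.sum_eq_zero fun e he => ?_
    rw [mem_mon] at he
    rw [if_neg]
    intro hd
    have := natDegree_le_of_dvd hd he.1.ne_zero
    omega

lemma newton_id (ψ : F[X] → ℤ) (hψ : ∀ a b, ψ (a * b) = ψ a * ψ b) (hψ1 : ψ 1 = 1) (k : ℕ) :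
    (k : ℤ) * ∑ e ∈ mon F k, ψ e =
      ∑ j ∈ Finset.Icc 1 k, Ssum F ψ j * ∑ e ∈ mon F (k - j), ψ e := by
  have hpow : ∀ (p : F[X]) (i : ℕ), ψ (p ^ i) = ψ p ^ i := by
    intro p i
    induction i with
    | zero => simp [hψ1]
    | succ i ih => rw [pow_succ, hψ, ih, pow_succ]
  calc (k : ℤ) * ∑ e ∈ mon F k, ψ e
      = ∑ e ∈ mon F k, ψ e * ((∑ p ∈ irrs F k, p.natDegree * ∑ i ∈ Finset.Icc 1 k, if p ^ i ∣ e then 1 else 0 : ℕ) : ℤ) := by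
        rw [Finset.mul_sum]
        refine Finset.sum_congr rfl fun e he => ?_
        rw [deg_eq_sum F he, mul_comm]
    _ = ∑ e ∈ mon F k, ∑ p ∈ irrs F k, ∑ i ∈ Finset.Icc 1 k, (p.natDegree : ℤ) * if p ^ i ∣ e then ψ e else 0 := by
        refine Finset.sum_congr rfl fun e he => ?_
        push_cast
        rw [Finset.mul_sum]
        refine Finset.sum_congr rfl fun p hp => ?_
        rw [Finset.mul_sum, Finset.mul_sum]
        refine Finset.sum_congr rfl fun i hi => ?_
        split_ifs <;> simp [mul_comm]
    _ = ∑ p ∈ irrs F k, ∑ i ∈ Finset.Icc 1 k, (p.natDegree : ℤ) * ∑ e ∈ mon F k, if p ^ i ∣ e then ψ e else 0 := by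
        rw [Finset.sum_comm]
        refine Finset.sum_congr rfl fun p hp => ?_
        rw [Finset.sum_comm]
        refine Finset.sum_congr rfl fun i hi => ?_
        rw [Finset.mul_sum]
    _ = ∑ p ∈ irrs F k, ∑ i ∈ Finset.Icc 1 k, ∑ j ∈ Finset.Icc 1 k, if i * p.natDegree = j then (p.natDegree : ℤ) * ψ p ^ i * ∑ e ∈ mon F (k - j), ψ e else 0 := by
        refine Finset.sum_congr rfl fun p hp => Finset.sum_congr rfl fun i hi => ?_
        obtain ⟨hp1, hp2, hp3⟩ := (mem_irrs F).1 hp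
        rw [sum_dvd F ψ (hp2.pow i), hp2.natDegree_pow, Finset.sum_ite_eq]
        have : 1 ≤ i * p.natDegree := Nat.mul_pos (Finset.mem_Icc.1 hi).1 hp1.natDegree_pos
        simp only [Finset.mem_Icc, this, true_and]
        split_ifs with h
        · rw [mul_assoc, Finset.mul_sum (a := ψ p ^ i)]
          congr 1
          exact Finset.sum_congr rfl fun b _ => by rw [hψ, hpow]
        · simp
    _ = ∑ j ∈ Finset.Icc 1 k, Ssum F ψ j * ∑ e ∈ mon F (k - j), ψ e := by
        have : ∀ j ∈ Finset.Icc 1 k, Ssum F ψ j * ∑ e ∈ mon F (k - j), ψ e =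
          ∑ p ∈ irrs F k, ∑ i ∈ Finset.Icc 1 k, if i * p.natDegree = j then (p.natDegree : ℤ) * ψ p ^ i * ∑ e ∈ mon F (k - j), ψ e else 0 := by
          intro j hj
          rw [Finset.mem_Icc] at hj
          rw [Ssum_eq F ψ hj.1 hj.2, Finset.sum_mul]
          refine Finset.sum_congr rfl fun p hp => ?_
          rw [Finset.sum_mul]
          refine Finset.sum_congr rfl fun i hi => ?_
          split_ifs <;> simp
        rw [Finset.sum_congr rfl this]
        symm
        refine Finset.sum_comm.trans ?_
        exact Finset.sum_congr rfl fun p _ => Finset.sum_comm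

lemma card_fiber (K : Type) [Field K] [Fintype K] [Algebra F K] (p : F[X]) (hp : Irreducible p) (hpm : p.Monic)
    (hd : p.natDegree ∣ Module.finrank F K) :
    (Finset.univ.filter fun x : K => minpoly F x = p).card = p.natDegree := by
  have hdv : p ∣ X ^ (Fintype.card K) - X := by
    have := (hp.natDegree_dvd_iff_dvd_X_pow_card_pow_sub_X (k := F) (n := Module.finrank F K)).1 hd
    rwa [← Module.natCard_eq_pow_finrank, Nat.card_eq_fintype_card] at this
  have hdv' : p.map (algebraMap F K) ∣ X ^ (Fintype.card K) - X := by
    have := Polynomial.map_dvd (algebraMap F K) hdv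
    simpa using this
  have h0 : (X ^ (Fintype.card K) - X : K[X]) ≠ 0 := FiniteField.X_pow_card_sub_X_ne_zero K Fintype.one_lt_card
  have hspl : (X ^ (Fintype.card K) - X : K[X]).Splits := by
    rw [splits_iff_card_roots, FiniteField.roots_X_pow_card_sub_X, FiniteField.X_pow_card_sub_X_natDegree_eq K Fintype.one_lt_card]
    rfl
  have hsplit : (p.map (algebraMap F K)).Splits := hspl.of_dvd h0 hdv'
  have hle := roots.le_of_dvd h0 hdv'
  have hnd : (p.map (algebraMap F K)).roots.Nodup := by
    apply Multiset.nodup_of_le hle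
    rw [FiniteField.roots_X_pow_card_sub_X]
    exact Finset.univ.nodup
  have hcard := splits_iff_card_roots.1 hsplit
  rw [natDegree_map] at hcard
  rw [← hcard, ← Multiset.toFinset_card_of_nodup hnd]
  congr 1
  ext x
  rw [Finset.mem_filter, Multiset.mem_toFinset, mem_roots ((hpm.map _).ne_zero), IsRoot.def, eval_map_algebraMap]
  constructor
  · rintro ⟨_, rfl⟩; exact minpoly.aeval F x
  · intro h; exact ⟨Finset.mem_univ _, (minpoly.eq_of_irreducible_of_monic hp h hpm).symm⟩

lemma sum_char_ext (hodd : Odd (Fintype.card F)) (K : Type) [Field K] [Fintype K] [Algebra F K]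
    (heven : Even (Module.finrank F K)) (m : F[X]) (hm : m.Monic) :
    ∑ x : K, quadraticChar K (aeval x m) = Ssum F (fun e => chi F e m) (Module.finrank F K) := by
  set s := Module.finrank F K with hs
  have hspos : 0 < s := Module.finrank_pos
  have hdvd : ∀ x : K, (minpoly F x).natDegree ∣ s := by
    intro x
    exact minpoly.degree_dvd (Algebra.IsIntegral.isIntegral x)
  have hmem : ∀ x ∈ (Finset.univ : Finset K), minpoly F x ∈ irrs F s := by
    intro x _
    have hx : IsIntegral F x := Algebra.IsIntegral.isIntegral _
    rw [mem_irrs]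
    exact ⟨minpoly.irreducible hx, minpoly.monic hx, Nat.le_of_dvd hspos (hdvd x)⟩
  rw [← Finset.sum_fiberwise_of_maps_to hmem]
  unfold Ssum
  refine Finset.sum_congr rfl fun p hp => ?_
  obtain ⟨hp1, hp2, hp3⟩ := (mem_irrs F).1 hp
  by_cases hd : p.natDegree ∣ s
  · obtain ⟨i, hi⟩ := hd
    have hipos : 1 ≤ i := by
      rcases Nat.eq_zero_or_pos i with h | h
      · rw [h] at hi; omega
      · exact h
    have hile : i ≤ s := by rw [hi]; exact Nat.le_mul_of_pos_left _ hp1.natDegree_pos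
    rw [Finset.sum_eq_single_of_mem i (Finset.mem_Icc.2 ⟨hipos, hile⟩)]
    · rw [if_pos (by rw [hi, mul_comm]), Finset.sum_congr rfl (g := fun _ => chi F p m ^ i)]
      · rw [Finset.sum_const, card_fiber F K p hp1 hp2 ⟨i, hi⟩, nsmul_eq_mul]
      · intro x hx
        have hx := (Finset.mem_filter.1 hx).2
        have := char_eval_eq F hodd K heven m hm x i (by rw [hx, ← hi])
        rw [this, hx]
    · intro b _ hb
      rw [if_neg]
      intro h
      apply hb
      rw [hi, mul_comm] at h
      exact Nat.eq_of_mul_eq_mul_left hp1.natDegree_pos h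
  · rw [Finset.sum_eq_zero, Finset.sum_eq_zero]
    · intro i _
      rw [if_neg]
      intro h; exact hd ⟨i, by rw [← h, mul_comm]⟩
    · intro x hx
      exact absurd ((Finset.mem_filter.1 hx).2 ▸ hdvd x) hd

lemma hns_ext (m : F[X]) (hm : m.Monic) (hns : ¬ ∃ v : F[X], v.Monic ∧ m = v ^ 2)
    (K : Type) [Field K] [Algebra F K] (c : K) (a b : K[X]) (hc : c ≠ 0)
    (h : C c * m.map (algebraMap F K) * b ^ 2 = a ^ 2) : b = 0 := by
  by_contra hb
  obtain ⟨p, k, m', hpi, hpm, hm', hk, rfl, hnd⟩ := exists_odd_prime F m hm hns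
  let E := AlgebraicClosure K
  obtain ⟨y, hy⟩ := IsAlgClosed.exists_aeval_eq_zero E p (degree_pos_of_irreducible hpi).ne'
  have hsep : p.Separable := PerfectField.separable_of_irreducible hpi
  have hE := congrArg (Polynomial.map (algebraMap K E)) h
  simp only [Polynomial.map_mul, Polynomial.map_pow, Polynomial.map_map, Polynomial.map_C, ← IsScalarTower.algebraMap_eq F K E] at hE
  have hb' : b.map (algebraMap K E) ≠ 0 := (Polynomial.map_ne_zero_iff (algebraMap K E).injective).2 hb
  have hp0 : p.map (algebraMap F E) ≠ 0 := (Polynomial.map_ne_zero_iff (algebraMap F E).injective).2 hpi.ne_zero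
  have hm0 : m'.map (algebraMap F E) ≠ 0 := (Polynomial.map_ne_zero_iff (algebraMap F E).injective).2 hm'.ne_zero
  have hc' : (C (algebraMap K E c)) ≠ 0 := by
    rw [Ne, C_eq_zero]; exact (_root_.map_ne_zero _).2 hc
  have hmult := congrArg (rootMultiplicity y) hE
  have hl : C (algebraMap K E c) * (p.map (algebraMap F E) ^ k * m'.map (algebraMap F E)) ≠ 0 :=
    mul_ne_zero hc' (mul_ne_zero (pow_ne_zero _ hp0) hm0)
  have ha' : a.map (algebraMap K E) ^ 2 ≠ 0 := by
    rw [← hE]; exact mul_ne_zero hl (pow_ne_zero _ hb')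
  have hpowm : ∀ (g : E[X]) (n : ℕ), rootMultiplicity y (g ^ n) = n * rootMultiplicity y g := by
    intro g n
    rw [← count_roots, ← count_roots, roots_pow, Multiset.count_nsmul]
  rw [rootMultiplicity_mul (mul_ne_zero hl (pow_ne_zero _ hb')), rootMultiplicity_mul hl,
    rootMultiplicity_mul (mul_ne_zero (pow_ne_zero _ hp0) hm0), rootMultiplicity_C, hpowm, hpowm, hpowm] at hmult
  have h1 : rootMultiplicity y (p.map (algebraMap F E)) = 1 := by
    apply le_antisymm
    · exact rootMultiplicity_le_one_of_separable (hsep.map) y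
    · rw [Nat.one_le_iff_ne_zero, Ne, rootMultiplicity_eq_zero_iff]
      push Not
      refine ⟨?_, hp0⟩
      rw [IsRoot.def, eval_map_algebraMap, hy]
  have h2 : rootMultiplicity y (m'.map (algebraMap F E)) = 0 := by
    rw [rootMultiplicity_eq_zero_iff]
    intro hr
    exfalso
    apply hnd
    rw [IsRoot.def, eval_map_algebraMap] at hr
    have := minpoly.dvd F y hr
    rwa [← minpoly.eq_of_irreducible_of_monic hpi hy hpm] at this
  rw [h1, h2] at hmult
  obtain ⟨r, hr⟩ := hk
  omega

lemma S_bound (hodd : Odd (Fintype.card F)) (m : F[X]) (hm : m.Monic) (hns : ¬ ∃ v : F[X], v.Monic ∧ m = v ^ 2)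
    (h : ℕ) (hh : 4 * m.natDegree + 1 ≤ h) :
    |Ssum F (fun e => chi F e m) (2 * h)| ≤ 3 * m.natDegree * (Fintype.card F : ℤ) ^ h := by
  obtain ⟨p, hchar⟩ := CharP.exists F
  obtain ⟨n, hp, hn⟩ := FiniteField.card F p
  have : Fact p.Prime := ⟨hp⟩
  have : NeZero (2 * h) := ⟨by omega⟩
  let K := FiniteField.Extension F p (2 * h)
  let _ : Fintype K := Fintype.ofFinite K
  have hfr : Module.finrank F K = 2 * h := FiniteField.finrank_extension F p (2 * h)
  have hcK : Fintype.card K = Fintype.card F ^ (2 * h) := by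
    have := FiniteField.natCard_extension F p (2 * h)
    rwa [Nat.card_eq_fintype_card, Nat.card_eq_fintype_card] at this
  have hcharK : CharP K p := charP_of_injective_algebraMap (algebraMap F K).injective p
  have hR : p ^ (n * h : ℕ) = Fintype.card F ^ h := by rw [hn, pow_mul]
  have hodd2 : Odd (Fintype.card F ^ h) := hodd.pow
  obtain ⟨t, ht⟩ := hodd2
  have hcard1 : 1 < Fintype.card F := Fintype.one_lt_card
  have hbig : 4 * m.natDegree + 1 < Fintype.card F ^ h := lt_of_le_of_lt hh (Nat.lt_pow_self hcard1)
  have hm1 : 1 ≤ m.natDegree := by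
    by_contra h0
    have : m = 1 := hm.natDegree_eq_zero.1 (by omega)
    exact hns ⟨1, monic_one, by simp [this]⟩
  have := weil_aux (K := K) p (n * h) (m.map (algebraMap F K)) t (by rw [hR, ht])
    (by rw [hR, hcK, ← pow_mul, mul_comm]) (fun c a b hc hab => hns_ext F m hm hns K c a b hc hab)
    (by rwa [natDegree_map]) (by rw [natDegree_map]; omega)
  rw [natDegree_map, hR] at this
  have h2 := sum_char_ext F hodd K (by rw [hfr]; exact even_two_mul h) m hm
  rw [hfr] at h2
  rw [← h2]
  simp only [eval_map_algebraMap] at this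
  exact_mod_cast this

lemma bounded_powersum {ι : Type} [Fintype ι] (β : ι → ℂ) (A : ℝ) (h0 : ℕ)
    (hb : ∀ h, h0 ≤ h → ‖∑ i, β i ^ h‖ ≤ A) (i : ι) : ‖β i‖ ≤ 1 := by
  by_contra hcon
  push Not at hcon
  let P : ℂ[X] := ∏ b ∈ (Finset.univ.image β).erase (β i), (X - C b)
  have hP0 : P.eval (β i) ≠ 0 := by
    simp only [P, eval_prod, eval_sub, eval_X, eval_C]
    rw [Finset.prod_ne_zero_iff]
    intro b hb
    exact sub_ne_zero.2 (Finset.ne_of_mem_erase hb).symm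
  have hPj : ∀ j, β j ≠ β i → P.eval (β j) = 0 := by
    intro j hj
    simp only [P, eval_prod, eval_sub, eval_X, eval_C]
    apply Finset.prod_eq_zero (i := β j)
    · exact Finset.mem_erase.2 ⟨hj, Finset.mem_image_of_mem _ (Finset.mem_univ _)⟩
    · simp
  set N := (Finset.univ.filter fun j => β j = β i).card with hN
  have hNpos : 1 ≤ N := Finset.card_pos.2 ⟨i, by simp⟩
  have hid : ∀ h, ∑ k ∈ Finset.range (P.natDegree + 1), P.coeff k * ∑ j, β j ^ (h + k) = N * (β i ^ h * P.eval (β i)) := by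
    intro h
    calc ∑ k ∈ Finset.range (P.natDegree + 1), P.coeff k * ∑ j, β j ^ (h + k)
        = ∑ j, β j ^ h * P.eval (β j) := by
          simp_rw [Finset.mul_sum]
          rw [Finset.sum_comm]
          refine Finset.sum_congr rfl fun j _ => ?_
          rw [eval_eq_sum_range, Finset.mul_sum]
          refine Finset.sum_congr rfl fun k _ => ?_
          rw [pow_add]; ring
      _ = ∑ j ∈ Finset.univ.filter (fun j => β j = β i), β j ^ h * P.eval (β j) := by
          rw [Finset.sum_filter]
          refine Finset.sum_congr rfl fun j _ => ?_
          split_ifs with hj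
          · rfl
          · rw [hPj j hj, mul_zero]
      _ = _ := by
          rw [Finset.sum_congr rfl (g := fun _ => β i ^ h * P.eval (β i))]
          · rw [Finset.sum_const, nsmul_eq_mul]
          · intro j hj
            rw [(Finset.mem_filter.1 hj).2]
  have hbd : ∀ h, h0 ≤ h → ‖β i‖ ^ h ≤ (∑ k ∈ Finset.range (P.natDegree + 1), ‖P.coeff k‖ * A) / ‖P.eval (β i)‖ := by
    intro h hh
    have h1 : ‖∑ k ∈ Finset.range (P.natDegree + 1), P.coeff k * ∑ j, β j ^ (h + k)‖ ≤
        ∑ k ∈ Finset.range (P.natDegree + 1), ‖P.coeff k‖ * A := by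
      refine (norm_sum_le _ _).trans (Finset.sum_le_sum fun k _ => ?_)
      rw [norm_mul]
      exact mul_le_mul_of_nonneg_left (hb _ (by omega)) (norm_nonneg _)
    rw [hid, norm_mul, norm_mul, norm_pow, Complex.norm_natCast] at h1
    rw [le_div_iff₀ (norm_pos_iff.2 hP0)]
    refine le_trans ?_ h1
    have : (1:ℝ) ≤ N := by exact_mod_cast hNpos
    exact le_mul_of_one_le_left (by positivity) this
  obtain ⟨h, hh⟩ := pow_unbounded_of_one_lt ((∑ k ∈ Finset.range (P.natDegree + 1), ‖P.coeff k‖ * A) / ‖P.eval (β i)‖) hcon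
  have h2 := hbd (h + h0) (by omega)
  have h3 : ‖β i‖ ^ h ≤ ‖β i‖ ^ (h + h0) := pow_le_pow_right₀ hcon.le (by omega)
  linarith

lemma rh_deduce (c S : ℕ → ℂ) (N : ℕ) (hc0 : c 0 = 1) (hcN : ∀ k, N < k → c k = 0)
    (hnew : ∀ k : ℕ, (k : ℂ) * c k = ∑ j ∈ Finset.Icc 1 k, S j * c (k - j))
    (q A : ℝ) (hq : 0 < q) (h0 : ℕ) (hS : ∀ h, h0 ≤ h → ‖S (2 * h)‖ ≤ A * q ^ h) (k : ℕ) :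
    ‖c k‖ ≤ N.choose k * Real.sqrt q ^ k := by
  let Q : ℂ[X] := ∑ k ∈ Finset.range (N + 1), C (c k) * X ^ (N - k)
  have hcoeff : ∀ k, k ≤ N → Q.coeff (N - k) = c k := by
    intro k hk
    simp only [Q, finsetSum_coeff, coeff_C_mul, coeff_X_pow]
    rw [Finset.sum_eq_single k]
    · simp
    · intro b hb hbk
      rw [Finset.mem_range] at hb
      rw [if_neg (by omega), mul_zero]
    · intro h; exact absurd (Finset.mem_range.2 (by omega)) h
  have hdegle : Q.natDegree ≤ N := by
    apply natDegree_sum_le_of_forall_le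
    intro i _
    exact (natDegree_C_mul_X_pow_le _ _).trans (by omega)
  have hmonic : Q.Monic := monic_of_natDegree_le_of_coeff_eq_one N hdegle (by simpa [hc0] using hcoeff 0 (by omega))
  have hdeg : Q.natDegree = N := by
    apply le_antisymm hdegle
    apply le_natDegree_of_ne_zero
    have := hcoeff 0 (by omega)
    simp only [Nat.sub_zero] at this
    rw [this, hc0]; exact one_ne_zero
  have hsplit : Q.Splits := IsAlgClosed.splits Q
  have hcard : Q.roots.card = N := by rw [splits_iff_card_roots.1 hsplit, hdeg]
  let α : Q.roots.ToType → ℂ := fun x => (x : ℂ)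
  have hα : (Finset.univ : Finset Q.roots.ToType).val.map α = Q.roots := Multiset.map_univ_coe _
  have hcard2 : Fintype.card Q.roots.ToType = N := by
    rw [Multiset.card_coe, hcard]
  have hes : ∀ k, c k = (-1) ^ k * MvPolynomial.aeval α (MvPolynomial.esymm Q.roots.ToType ℂ k) := by
    intro k
    rw [MvPolynomial.aeval_esymm_eq_multiset_esymm, hα]
    by_cases hk : k ≤ N
    · rw [← hcoeff k hk, coeff_eq_esymm_roots_of_card (splits_iff_card_roots.1 hsplit) (by omega), hmonic.leadingCoeff, hdeg,
        show N - (N - k) = k by omega, one_mul]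
    · rw [hcN k (by omega), Multiset.esymm, Multiset.powersetCard_eq_empty _ (by omega)]
      simp
  have hps : ∀ j, MvPolynomial.aeval α (MvPolynomial.psum Q.roots.ToType ℂ j) = ∑ i, α i ^ j := by
    intro j
    simp [MvPolynomial.psum]
  have hnew2 : ∀ k : ℕ, (k : ℂ) * c k = - ∑ a ∈ Finset.range k, c a * ∑ i, α i ^ (k - a) := by
    intro k
    have h1 := congrArg (MvPolynomial.aeval α) (MvPolynomial.mul_esymm_eq_sum Q.roots.ToType ℂ k)
    simp only [map_mul, map_natCast, map_pow, map_neg, map_one, map_sum, hps] at h1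
    rw [Finset.sum_filter, Finset.Nat.sum_antidiagonal_eq_sum_range_succ_mk, Finset.sum_range_succ] at h1
    simp only [lt_irrefl, if_false, add_zero] at h1
    have h2 : (k : ℂ) * c k = (-1) ^ k * (k * MvPolynomial.aeval α (MvPolynomial.esymm Q.roots.ToType ℂ k)) := by
      rw [hes k]; ring
    rw [h2, h1, ← mul_assoc, ← pow_add, Odd.neg_one_pow ⟨k, by ring⟩, neg_one_mul]
    congr 1
    refine Finset.sum_congr rfl fun a ha => ?_
    rw [if_pos (Finset.mem_range.1 ha), ← hes]
  have hnew3 : ∀ k : ℕ, (k : ℂ) * c k = ∑ a ∈ Finset.range k, c a * S (k - a) := by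
    intro k
    rw [hnew]
    refine Finset.sum_nbij' (fun j => k - j) (fun a => k - a) ?_ ?_ ?_ ?_ ?_
    · intro j hj; rw [Finset.mem_Icc] at hj; rw [Finset.mem_range]; omega
    · intro j hj; rw [Finset.mem_range] at hj; rw [Finset.mem_Icc]; omega
    · intro j hj; rw [Finset.mem_Icc] at hj; omega
    · intro j hj; rw [Finset.mem_range] at hj; omega
    · intro j hj; rw [Finset.mem_Icc] at hj
      rw [show k - (k - j) = j by omega, mul_comm]
  have hSp : ∀ j, 1 ≤ j → S j = - ∑ i, α i ^ j := by
    intro j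
    induction j using Nat.strong_induction_on with
    | _ j ih =>
      intro hj
      have h1 := (hnew3 j).symm.trans (hnew2 j)
      obtain ⟨j', rfl⟩ : ∃ j', j = j' + 1 := ⟨j - 1, by omega⟩
      rw [Finset.sum_range_succ', Finset.sum_range_succ', hc0, neg_add] at h1
      have h2 : ∑ a ∈ Finset.range j', c (a + 1) * S (j' + 1 - (a + 1)) = - ∑ a ∈ Finset.range j', c (a + 1) * ∑ i, α i ^ (j' + 1 - (a + 1)) := by
        rw [← Finset.sum_neg_distrib]
        refine Finset.sum_congr rfl fun a ha => ?_
        rw [Finset.mem_range] at ha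
        rw [ih _ (by omega) (by omega)]; ring
      rw [h2] at h1
      have h3 := add_left_cancel h1
      simpa using h3
  have hroot : ∀ z ∈ Q.roots, ‖z‖ ≤ Real.sqrt q := by
    intro z hz
    rw [← hα, Multiset.mem_map] at hz
    obtain ⟨i, _, rfl⟩ := hz
    have := bounded_powersum (fun i => α i ^ 2 / (q : ℂ)) A (h0 + 1) ?_ i
    · rw [norm_div, norm_pow, Complex.norm_real, Real.norm_of_nonneg hq.le, div_le_one hq] at this
      exact Real.le_sqrt_of_sq_le this
    · intro h hh
      have h1 := hS h (by omega)
      rw [hSp _ (by omega), norm_neg] at h1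
      have h2 : ∑ i, (α i ^ 2 / (q : ℂ)) ^ h = (∑ i, α i ^ (2 * h)) / (q : ℂ) ^ h := by
        rw [Finset.sum_div]
        exact Finset.sum_congr rfl fun i _ => by rw [div_pow, pow_mul]
      rw [h2, norm_div, norm_pow, Complex.norm_real, Real.norm_of_nonneg hq.le, div_le_iff₀ (by positivity)]
      exact h1
  by_cases hk : k ≤ N
  · have := coeff_le_of_roots_le (p := Q) (f := RingHom.id ℂ) (B := Real.sqrt q) (N - k) hmonic (by simpa using hsplit) (by simpa using hroot)
    rw [Polynomial.map_id, hcoeff k hk, hdeg, show N - (N - k) = k by omega, Nat.choose_symm hk, mul_comm] at this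
    exact this
  · rw [hcN k (by omega), norm_zero]; positivity

/-- Character sum bound. -/
lemma csum_bound (hodd : Odd (Fintype.card F)) (m : F[X]) (hm : m.Monic) (hns : ¬ ∃ v : F[X], v.Monic ∧ m = v ^ 2)
    (k : ℕ) : |((∑ e ∈ mon F k, chi F e m : ℤ) : ℝ)| ≤ 2 ^ (m.natDegree - 1) * Real.sqrt (Fintype.card F) ^ k := by
  have hm1 : 1 ≤ m.natDegree := by
    by_contra h0
    have : m = 1 := hm.natDegree_eq_zero.1 (by omega)
    exact hns ⟨1, monic_one, by simp [this]⟩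
  have hmon0 : mon F 0 = {1} := by
    ext e
    rw [mem_mon, Finset.mem_singleton]
    constructor
    · rintro ⟨h1, h2⟩; exact h1.natDegree_eq_zero.1 h2
    · rintro rfl; exact ⟨monic_one, natDegree_one⟩
  have := rh_deduce (fun k => ((∑ e ∈ mon F k, chi F e m : ℤ) : ℂ)) (fun j => ((Ssum F (fun e => chi F e m) j : ℤ) : ℂ))
    (m.natDegree - 1) (by simp [hmon0, chi_one_left F m hm])
    (fun k hk => by rw [csum_vanish F hodd m hm hns k (by omega)]; simp)
    (fun k => by
      have := newton_id F (fun e => chi F e m) (fun a b => chi_mul F hodd m hm a b) (chi_one_left F m hm) k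
      exact_mod_cast this)
    (Fintype.card F) (3 * m.natDegree) (by exact_mod_cast Fintype.card_pos) (4 * m.natDegree + 1)
    (fun h hh => by
      have := S_bound F hodd m hm hns h hh
      rw [Complex.norm_intCast]
      exact_mod_cast this) k
  rw [Complex.norm_intCast] at this
  refine this.trans ?_
  gcongr
  exact_mod_cast Nat.choose_le_two_pow _ _

lemma sq_decomp_exists (n : ℕ) : ∀ e : F[X], e.Monic → e.natDegree = n →
    ∃ d b : F[X], d.Monic ∧ b.Monic ∧ Squarefree d ∧ e = d * b ^ 2 := by
  induction n using Nat.strong_induction_on with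
  | _ n ih =>
    intro e he hn
    by_cases hs : Squarefree e
    · exact ⟨e, 1, he, monic_one, hs, by simp⟩
    · unfold Squarefree at hs
      push Not at hs
      obtain ⟨x, hx, hxu⟩ := hs
      have hx0 : x ≠ 0 := by
        rintro rfl
        apply he.ne_zero
        simpa using hx
      have hy : normalize x * normalize x ∣ e := (mul_dvd_mul (normalize_dvd_iff.2 dvd_rfl) (normalize_dvd_iff.2 dvd_rfl)).trans hx
      have hym : (normalize x).Monic := monic_normalize hx0
      set y := normalize x with hydef
      have hyd : 1 ≤ y.natDegree := by
        by_contra h0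
        have h1 : y = 1 := hym.natDegree_eq_zero.1 (by omega)
        apply hxu
        exact normalize_eq_one.1 (hydef ▸ h1)
      obtain ⟨e', rfl⟩ := hy
      have he' : e'.Monic := (hym.mul hym).of_mul_monic_left he
      rw [(hym.mul hym).natDegree_mul he', hym.natDegree_mul hym] at hn
      obtain ⟨d, b, hd, hb, hsq, heq⟩ := ih e'.natDegree (by omega) e' he' rfl
      exact ⟨d, b * y, hd, hb.mul hym, hsq, by rw [heq]; ring⟩

lemma sq_decomp_unique {d b d' b' : F[X]} (hd : d.Monic) (hb : b.Monic) (hs : Squarefree d)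
    (hd' : d'.Monic) (hb' : b'.Monic) (hs' : Squarefree d') (h : d * b ^ 2 = d' * b' ^ 2) : d = d' ∧ b = b' := by
  have key : ∀ {d b : F[X]}, d.Monic → b.Monic → Squarefree d → ∀ p,
      (normalizedFactors b).count p = (normalizedFactors (d * b ^ 2)).count p / 2 := by
    intro d b hd hb hs p
    rw [normalizedFactors_mul hd.ne_zero (pow_ne_zero _ hb.ne_zero), normalizedFactors_pow, Multiset.count_add, Multiset.count_nsmul]
    have := Multiset.nodup_iff_count_le_one.1 ((squarefree_iff_nodup_normalizedFactors hd.ne_zero).1 hs) p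
    omega
  have hbb : b = b' := by
    rw [← prod_nf F hb, ← prod_nf F hb']
    congr 1
    ext p
    rw [key hd hb hs p, key hd' hb' hs' p, h]
  subst hbb
  exact ⟨mul_right_cancel₀ (pow_ne_zero _ hb.ne_zero) h, rfl⟩

lemma sum_decomp (w : F[X] → ℤ) (n : ℕ) :
    ∑ e ∈ mon F n, w e = ∑ j ∈ Finset.range (n / 2 + 1), ∑ b ∈ mon F j, ∑ d ∈ sfs F (n - 2 * j), w (d * b ^ 2) := by
  have h1 : ∀ j ∈ Finset.range (n / 2 + 1), (∑ b ∈ mon F j, ∑ d ∈ sfs F (n - 2 * j), w (d * b ^ 2)) =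
      ∑ x ∈ mon F j ×ˢ sfs F (n - 2 * j), w (x.2 * x.1 ^ 2) := by
    intro j _
    rw [Finset.sum_product]
  rw [Finset.sum_congr rfl h1, Finset.sum_sigma']
  symm
  refine Finset.sum_bij (fun x _ => x.2.2 * x.2.1 ^ 2) ?_ ?_ ?_ ?_
  · rintro ⟨j, b, d⟩ hx
    simp only [Finset.mem_sigma, Finset.mem_range, Finset.mem_product, mem_mon, mem_sfs] at hx
    obtain ⟨hj, ⟨hb, hbj⟩, ⟨hd, hdj⟩, hs⟩ := hx
    rw [mem_mon]
    refine ⟨hd.mul (hb.pow 2), ?_⟩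
    rw [hd.natDegree_mul (hb.pow 2), hb.natDegree_pow]
    omega
  · rintro ⟨j, b, d⟩ hx ⟨j', b', d'⟩ hx' heq
    simp only [Finset.mem_sigma, Finset.mem_range, Finset.mem_product, mem_mon, mem_sfs] at hx hx' heq
    obtain ⟨hj, ⟨hb, hbj⟩, ⟨hd, hdj⟩, hs⟩ := hx
    obtain ⟨hj', ⟨hb', hbj'⟩, ⟨hd', hdj'⟩, hs'⟩ := hx'
    obtain ⟨h1, h2⟩ := sq_decomp_unique F hd hb hs hd' hb' hs' heq
    subst h1 h2
    rw [hbj] at hbj'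
    subst hbj'
    rfl
  · intro e he
    rw [mem_mon] at he
    obtain ⟨d, b, hd, hb, hs, rfl⟩ := sq_decomp_exists F n e he.1 he.2
    have h2 := he.2
    rw [hd.natDegree_mul (hb.pow 2), hb.natDegree_pow] at h2
    refine ⟨⟨b.natDegree, b, d⟩, ?_, rfl⟩
    simp only [Finset.mem_sigma, Finset.mem_range, Finset.mem_product, mem_mon, mem_sfs]
    refine ⟨by omega, ⟨hb, trivial⟩, ⟨hd, by omega⟩, hs⟩
  · intros; rfl

/-- `e` is divisible by no element of `T`. -/
def av (T : Finset F[X]) (e : F[X]) : Prop := ∀ p ∈ T, ¬ p ∣ e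

/-- Number of monic polynomials avoiding `T`. -/
def Bc (T : Finset F[X]) (n : ℕ) : ℤ := ∑ e ∈ mon F n, if av F T e then 1 else 0

/-- Number of monic squarefree polynomials avoiding `T`. -/
def Ac (T : Finset F[X]) (n : ℕ) : ℤ := ∑ e ∈ mon F n, if Squarefree e ∧ av F T e then 1 else 0

lemma av_insert (T : Finset F[X]) (p e : F[X]) : av F (insert p T) e ↔ ¬ p ∣ e ∧ av F T e := by
  simp [av]

lemma av_mul (T : Finset F[X]) (hT : ∀ r ∈ T, Irreducible r ∧ r.Monic) (p e : F[X]) (hp : Irreducible p) (hpm : p.Monic)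
    (hpT : p ∉ T) : av F T (p * e) ↔ av F T e := by
  constructor
  · intro h r hr hre
    exact h r hr (hre.mul_left p)
  · intro h r hr hre
    rcases (hT r hr).1.prime.dvd_or_dvd hre with h1 | h1
    · have := eq_of_monic_of_associated (hT r hr).2 hpm ((hT r hr).1.associated_of_dvd hp h1)
      exact hpT (this ▸ hr)
    · exact h r hr h1

lemma Bc_insert (T : Finset F[X]) (hT : ∀ r ∈ T, Irreducible r ∧ r.Monic) (p : F[X]) (hp : Irreducible p) (hpm : p.Monic)
    (hpT : p ∉ T) (n : ℕ) :
    Bc F T n = Bc F (insert p T) n + if p.natDegree ≤ n then Bc F T (n - p.natDegree) else 0 := by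
  have h := sum_dvd F (fun e => if av F T e then 1 else 0) hpm n
  simp only [av_mul F T hT p _ hp hpm hpT] at h
  unfold Bc
  rw [← h, ← Finset.sum_add_distrib]
  refine Finset.sum_congr rfl fun e _ => ?_
  rw [if_congr (av_insert F T p e) rfl rfl]
  by_cases h1 : p ∣ e <;> by_cases h2 : av F T e <;> simp [h1, h2]

lemma sqfree_mul_irr {p e : F[X]} (hp : Irreducible p) : Squarefree (p * e) ↔ Squarefree e ∧ ¬ p ∣ e := by
  constructor
  · intro h
    refine ⟨h.squarefree_of_dvd (dvd_mul_left _ _), fun hd => ?_⟩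
    exact hp.not_isUnit (h p (mul_dvd_mul_left p hd))
  · rintro ⟨h1, h2⟩
    rw [squarefree_mul_iff]
    exact ⟨(hp.coprime_iff_not_dvd.2 h2).isRelPrime, hp.squarefree, h1⟩

lemma Ac_insert (T : Finset F[X]) (hT : ∀ r ∈ T, Irreducible r ∧ r.Monic) (p : F[X]) (hp : Irreducible p) (hpm : p.Monic)
    (hpT : p ∉ T) (n : ℕ) :
    Ac F T n = Ac F (insert p T) n + if p.natDegree ≤ n then Ac F (insert p T) (n - p.natDegree) else 0 := by
  have h := sum_dvd F (fun e => if Squarefree e ∧ av F T e then 1 else 0) hpm n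
  simp only [av_mul F T hT p _ hp hpm hpT, sqfree_mul_irr F hp, and_assoc, ← av_insert F T p] at h
  unfold Ac
  rw [← h, ← Finset.sum_add_distrib]
  refine Finset.sum_congr rfl fun e _ => ?_
  simp only [av_insert F T p e]
  by_cases h1 : p ∣ e <;> by_cases h2 : av F T e <;> by_cases h3 : Squarefree e <;> simp [h1, h2, h3]

lemma Bc_empty (n : ℕ) : Bc F ∅ n = (Fintype.card F : ℤ) ^ n := by
  simp [Bc, av, card_mon]

lemma Ac_empty (n : ℕ) : Ac F ∅ n = (sfs F n).card := by
  simp [Ac, av, sfs]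

/-- Convolution. -/
def Uc (P : ℕ → ℤ) (T : Finset F[X]) (n : ℕ) : ℤ := ∑ j ∈ Finset.range (n / 2 + 1), Bc F T j * P (n - 2 * j)

lemma Uc_insert (P : ℕ → ℤ) (T : Finset F[X]) (hT : ∀ r ∈ T, Irreducible r ∧ r.Monic) (p : F[X]) (hp : Irreducible p) (hpm : p.Monic)
    (hpT : p ∉ T) (n : ℕ) :
    Uc F P T n = Uc F P (insert p T) n + if 2 * p.natDegree ≤ n then Uc F P T (n - 2 * p.natDegree) else 0 := by
  unfold Uc
  have h1 : ∀ j ∈ Finset.range (n / 2 + 1), Bc F T j * P (n - 2 * j) = Bc F (insert p T) j * P (n - 2 * j) +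
      if p.natDegree ≤ j then Bc F T (j - p.natDegree) * P (n - 2 * j) else 0 := by
    intro j _
    rw [Bc_insert F T hT p hp hpm hpT j]
    split_ifs <;> ring
  rw [Finset.sum_congr rfl h1, Finset.sum_add_distrib]
  congr 1
  rw [← Finset.sum_filter]
  split_ifs with h
  · symm
    refine Finset.sum_nbij' (fun i => i + p.natDegree) (fun j => j - p.natDegree) ?_ ?_ ?_ ?_ ?_
    · intro i hi; rw [Finset.mem_range] at hi; rw [Finset.mem_filter, Finset.mem_range]; omega
    · intro i hi; rw [Finset.mem_filter, Finset.mem_range] at hi; rw [Finset.mem_range]; omega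
    · intro i _; omega
    · intro i hi; rw [Finset.mem_filter] at hi; omega
    · intro i _
      rw [Nat.add_sub_cancel, show n - 2 * p.natDegree - 2 * i = n - 2 * (i + p.natDegree) by omega]
  · apply Finset.sum_eq_zero
    intro j hj
    rw [Finset.mem_filter, Finset.mem_range] at hj
    omega

lemma Uc_empty (P : ℕ → ℤ) (n : ℕ) : Uc F P ∅ (n + 2) = P (n + 2) + Fintype.card F * Uc F P ∅ n := by
  unfold Uc
  rw [show (n + 2) / 2 + 1 = (n / 2 + 1) + 1 by omega, Finset.sum_range_succ', add_comm]
  congr 1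
  · simp [Bc_empty]
  · rw [Finset.mul_sum]
    refine Finset.sum_congr rfl fun j _ => ?_
    rw [Bc_empty, Bc_empty, show n + 2 - 2 * (j + 1) = n - 2 * j by omega, pow_succ]; ring

lemma card_primes_le (m : F[X]) (hm : m.Monic) : (normalizedFactors m).toFinset.card ≤ m.natDegree := by
  have h4 := natDegree_multiset_prod_of_monic (normalizedFactors m) (fun p hp => ((mem_nf F hm.ne_zero).1 hp).2.1)
  rw [prod_nf F hm] at h4
  rw [h4]
  refine (Multiset.toFinset_card_le _).trans ?_
  rw [← Multiset.card_map (f := natDegree)]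
  have := Multiset.card_nsmul_le_sum (s := (normalizedFactors m).map natDegree) (a := 1) ?_
  · simpa using this
  · intro x hx
    obtain ⟨p, hp, rfl⟩ := Multiset.mem_map.1 hx
    exact ((mem_nf F hm.ne_zero).1 hp).1.natDegree_pos

lemma Uc_full (hodd : Odd (Fintype.card F)) (m : F[X]) (hm : m.Monic) (n : ℕ) :
    Uc F (fun n => ∑ d ∈ sfs F n, chi F d m) (normalizedFactors m).toFinset n = ∑ e ∈ mon F n, chi F e m := by
  rw [sum_decomp, Uc]
  refine Finset.sum_congr rfl fun j _ => ?_
  rw [Bc, Finset.sum_mul]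
  refine Finset.sum_congr rfl fun b _ => ?_
  rw [Finset.mul_sum]
  refine Finset.sum_congr rfl fun d _ => ?_
  rw [chi_mul F hodd m hm, sq, chi_mul F hodd m hm b b, chi_sq F b m hm, mul_comm]
  congr 1
  by_cases h : ∃ p ∈ normalizedFactors m, p ∣ b
  · rw [if_pos h, if_neg]
    intro ha
    obtain ⟨p, hp, hpb⟩ := h
    exact ha p (Multiset.mem_toFinset.2 hp) hpb
  · rw [if_neg h, if_pos]
    intro p hp hpb
    exact h ⟨p, Multiset.mem_toFinset.1 hp, hpb⟩

lemma card_ge_three (hodd : Odd (Fintype.card F)) : 3 ≤ Fintype.card F := by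
  have : 1 < Fintype.card F := Fintype.one_lt_card
  obtain ⟨r, hr⟩ := hodd
  omega

lemma Uc_bound (hodd : Odd (Fintype.card F)) (P : ℕ → ℤ) (T : Finset F[X]) (hT : ∀ r ∈ T, Irreducible r ∧ r.Monic) (M : ℝ) (hM : 0 ≤ M)
    (h : ∀ n, |(Uc F P T n : ℝ)| ≤ M * Real.sqrt (Fintype.card F) ^ n) :
    ∀ n, |(Uc F P ∅ n : ℝ)| ≤ (3 / 2) ^ T.card * M * Real.sqrt (Fintype.card F) ^ n := by
  have hq3 : (3 : ℝ) ≤ Fintype.card F := by exact_mod_cast card_ge_three F hodd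
  set s := Real.sqrt (Fintype.card F) with hs
  have hs2 : s ^ 2 = Fintype.card F := Real.sq_sqrt (by positivity)
  have hs1 : 1 ≤ s := by
    rw [hs, Real.one_le_sqrt]; linarith
  induction T using Finset.induction_on generalizing M with
  | empty => simpa using h
  | insert p T hpT ih =>
    have hT' : ∀ r ∈ T, Irreducible r ∧ r.Monic := fun r hr => hT r (Finset.mem_insert_of_mem hr)
    obtain ⟨hp, hpm⟩ := hT p (Finset.mem_insert_self _ _)
    have key : ∀ n, |(Uc F P T n : ℝ)| ≤ (3 / 2 * M) * s ^ n := by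
      intro n
      induction n using Nat.strong_induction_on with
      | _ n ihn =>
        rw [Uc_insert F P T hT' p hp hpm hpT n]
        have h1 := h n
        have h5 : 0 ≤ M * s ^ n := by positivity
        split_ifs with hn
        · have hpos := hp.natDegree_pos
          have h2 := ihn (n - 2 * p.natDegree) (by omega)
          have h3 : s ^ n = s ^ (n - 2 * p.natDegree) * s ^ (2 * p.natDegree) := by
            rw [← pow_add]; congr 1; omega
          have h4 : 3 ≤ s ^ (2 * p.natDegree) := by
            calc (3:ℝ) ≤ s ^ 2 := by rw [hs2]; exact hq3
              _ ≤ _ := pow_le_pow_right₀ hs1 (by omega)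
          have h6 : M * s ^ (n - 2 * p.natDegree) * 3 ≤ M * s ^ n := by
            rw [h3, ← mul_assoc]
            exact mul_le_mul_of_nonneg_left h4 (by positivity)
          push_cast
          refine (abs_add_le _ _).trans ?_
          linarith
        · rw [add_zero]; linarith
    have := ih hT' (3 / 2 * M) (by positivity) key
    intro n
    rw [Finset.card_insert_of_notMem hpT, pow_succ]
    refine (this n).trans (le_of_eq ?_)
    ring

lemma nonsquare_bound (hodd : Odd (Fintype.card F)) (m : F[X]) (hm : m.Monic) (hns : ¬ ∃ v : F[X], v.Monic ∧ m = v ^ 2)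
    (n : ℕ) : |((∑ d ∈ sfs F n, chi F d m : ℤ) : ℝ)| ≤ 3 ^ m.natDegree * Real.sqrt (Fintype.card F) ^ n := by
  have hq3 : (3 : ℝ) ≤ Fintype.card F := by exact_mod_cast card_ge_three F hodd
  have hm1 : 1 ≤ m.natDegree := by
    by_contra h0
    have : m = 1 := hm.natDegree_eq_zero.1 (by omega)
    exact hns ⟨1, monic_one, by simp [this]⟩
  set s := Real.sqrt (Fintype.card F) with hs
  have hs2 : s ^ 2 = Fintype.card F := Real.sq_sqrt (by positivity)
  let P : ℕ → ℤ := fun n => ∑ d ∈ sfs F n, chi F d m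
  have hT : ∀ r ∈ (normalizedFactors m).toFinset, Irreducible r ∧ r.Monic := by
    intro r hr
    rw [Multiset.mem_toFinset, mem_nf F hm.ne_zero] at hr
    exact ⟨hr.1, hr.2.1⟩
  have h1 := Uc_bound F hodd P _ hT (2 ^ (m.natDegree - 1)) (by positivity)
    (fun n => by rw [Uc_full F hodd m hm]; exact csum_bound F hodd m hm hns n)
  have hK : ((3:ℝ) / 2) ^ (normalizedFactors m).toFinset.card * 2 ^ (m.natDegree - 1) * 2 ≤ 3 ^ m.natDegree := by
    have : ((3:ℝ) / 2) ^ (normalizedFactors m).toFinset.card ≤ (3 / 2) ^ m.natDegree :=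
      pow_le_pow_right₀ (by norm_num) (card_primes_le F m hm)
    calc ((3:ℝ) / 2) ^ (normalizedFactors m).toFinset.card * 2 ^ (m.natDegree - 1) * 2
        = ((3:ℝ) / 2) ^ (normalizedFactors m).toFinset.card * 2 ^ m.natDegree := by
          rw [mul_assoc, ← pow_succ, Nat.sub_add_cancel hm1]
      _ ≤ (3 / 2) ^ m.natDegree * 2 ^ m.natDegree := by gcongr
      _ = _ := by rw [← mul_pow]; norm_num
  set K := ((3:ℝ) / 2) ^ (normalizedFactors m).toFinset.card * 2 ^ (m.natDegree - 1) with hKd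
  have hK0 : 0 ≤ K := by positivity
  have hsn : 0 ≤ s ^ n := by positivity
  have hfin : |(P n : ℝ)| ≤ K * 2 * s ^ n := by
    rcases Nat.lt_or_ge n 2 with hn | hn
    · have h2 := h1 n
      have h3 : Uc F P ∅ n = P n := by
        rw [Uc, show n / 2 + 1 = 1 by omega]
        simp [Bc_empty]
      rw [h3] at h2
      have : 0 ≤ K * s ^ n := by positivity
      linarith
    · obtain ⟨k, rfl⟩ : ∃ k, n = k + 2 := ⟨n - 2, by omega⟩
      have h2 := Uc_empty F P k
      have h3 : (P (k + 2) : ℝ) = Uc F P ∅ (k + 2) - Fintype.card F * Uc F P ∅ k := by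
        rw [h2]; push_cast; ring
      rw [h3]
      refine (abs_sub _ _).trans ?_
      have h4 := h1 (k + 2)
      have h5 := h1 k
      rw [abs_mul, abs_of_nonneg (by positivity : (0:ℝ) ≤ Fintype.card F), ← hs2]
      have h6 := mul_le_mul_of_nonneg_left h5 (by positivity : 0 ≤ s ^ 2)
      have h7 : s ^ 2 * (K * s ^ k) = K * s ^ (k + 2) := by ring
      linarith
  exact hfin.trans (mul_le_mul_of_nonneg_right hK hsn)

lemma card_sfs_rec (n : ℕ) : ((sfs F (n + 2)).card : ℤ) = (Fintype.card F : ℤ) ^ (n + 2) - (Fintype.card F : ℤ) ^ (n + 1) := by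
  have h : ∀ n, Uc F (fun n => ((sfs F n).card : ℤ)) ∅ n = (Fintype.card F : ℤ) ^ n := by
    intro n
    have := sum_decomp F (fun _ => 1) n
    rw [Finset.sum_const, card_mon] at this
    simp only [Finset.sum_const, card_mon] at this
    rw [Uc]
    simp only [Bc_empty]
    simp only [nsmul_eq_mul, mul_one] at this
    push_cast at this
    exact this.symm
  have h2 := Uc_empty F (fun n => ((sfs F n).card : ℤ)) n
  rw [h, h] at h2
  rw [pow_succ (Fintype.card F : ℤ) n]
  linarith

lemma card_sfs_lt (n : ℕ) (hn : n < 2) : ((sfs F n).card : ℤ) = (Fintype.card F : ℤ) ^ n := by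
  have h := sum_decomp F (fun _ => 1) n
  rw [show n / 2 + 1 = 1 by omega, Finset.sum_const, card_mon] at h
  simp [card_mon] at h
  exact_mod_cast h.symm

/-- Main term. -/
def Vc (T : Finset F[X]) : ℝ :=
  (1 - (Fintype.card F : ℝ)⁻¹) * ∏ p ∈ T, ((1 : ℝ) + ((Fintype.card F : ℝ) ^ p.natDegree)⁻¹)⁻¹

lemma Vc_nonneg (T : Finset F[X]) : 0 ≤ Vc F T ∧ Vc F T ≤ 1 := by
  have hq : (1 : ℝ) ≤ Fintype.card F := by exact_mod_cast Fintype.card_pos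
  have h1 : (Fintype.card F : ℝ)⁻¹ ≤ 1 := inv_le_one_of_one_le₀ hq
  have h2 : 0 ≤ (Fintype.card F : ℝ)⁻¹ := by positivity
  have h3 : 0 ≤ ∏ p ∈ T, ((1 : ℝ) + ((Fintype.card F : ℝ) ^ p.natDegree)⁻¹)⁻¹ := by positivity
  have h4 : ∏ p ∈ T, ((1 : ℝ) + ((Fintype.card F : ℝ) ^ p.natDegree)⁻¹)⁻¹ ≤ 1 := by
    apply Finset.prod_le_one
    · intro p _; positivity
    · intro p _
      apply inv_le_one_of_one_le₀
      have : 0 ≤ ((Fintype.card F : ℝ) ^ p.natDegree)⁻¹ := by positivity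
      linarith
  unfold Vc
  constructor
  · exact mul_nonneg (by linarith) h3
  · exact mul_le_one₀ (by linarith) h3 h4

lemma Ac_bound (hodd : Odd (Fintype.card F)) (T : Finset F[X]) (hT : ∀ r ∈ T, Irreducible r ∧ r.Monic) :
    ∀ n, |((Fintype.card F : ℝ) ^ n)⁻¹ * (Ac F T n : ℝ) - Vc F T| ≤ (5 / 2) ^ T.card * (Real.sqrt (Fintype.card F) ^ n)⁻¹ := by
  have hq3 : (3 : ℝ) ≤ Fintype.card F := by exact_mod_cast card_ge_three F hodd
  set s := Real.sqrt (Fintype.card F) with hs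
  have hs2 : s ^ 2 = Fintype.card F := Real.sq_sqrt (by positivity)
  have hs0 : 0 ≤ s := Real.sqrt_nonneg _
  have hs53 : 5 / 3 ≤ s := by nlinarith
  have hs1 : 1 ≤ s := by linarith
  have hspos : 0 < s := by linarith
  induction T using Finset.induction_on with
  | empty =>
    intro n
    rw [Ac_empty, Finset.card_empty, pow_zero, one_mul, Vc, Finset.prod_empty, mul_one]
    rcases Nat.lt_or_ge n 2 with hn | hn
    · rw [card_sfs_lt F n hn]
      push_cast
      rw [inv_mul_cancel₀ (by positivity), sub_sub_cancel, abs_of_nonneg (by positivity), ← hs2]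
      apply inv_anti₀ (by positivity)
      exact pow_le_pow_right₀ hs1 (by omega)
    · obtain ⟨k, rfl⟩ : ∃ k, n = k + 2 := ⟨n - 2, by omega⟩
      rw [card_sfs_rec]
      push_cast
      have : ((Fintype.card F : ℝ) ^ (k + 2))⁻¹ * ((Fintype.card F : ℝ) ^ (k + 2) - (Fintype.card F : ℝ) ^ (k + 1)) - (1 - (Fintype.card F : ℝ)⁻¹) = 0 := by
        have : (Fintype.card F : ℝ) ≠ 0 := by positivity
        field_simp
        ring
      rw [this, abs_zero]; positivity
  | insert p T hpT ih =>
    have hT' : ∀ r ∈ T, Irreducible r ∧ r.Monic := fun r hr => hT r (Finset.mem_insert_of_mem hr)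
    obtain ⟨hp, hpm⟩ := hT p (Finset.mem_insert_self _ _)
    have hpos := hp.natDegree_pos
    replace ih := ih hT'
    obtain ⟨hV0, hV1⟩ := Vc_nonneg F (insert p T)
    set K : ℝ := (5 / 2) ^ T.card with hK
    have hK1 : 1 ≤ K := one_le_pow₀ (by norm_num)
    set j := p.natDegree with hj
    set y : ℝ := (s ^ j)⁻¹ with hy
    have hy0 : 0 < y := by positivity
    have hyx : ((Fintype.card F : ℝ) ^ j)⁻¹ = y ^ 2 := by
      rw [hy, ← hs2, inv_pow, ← pow_mul, ← pow_mul, mul_comm]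
    have hy35 : y ≤ 3 / 5 := by
      rw [hy, show (3 / 5 : ℝ) = (5 / 3)⁻¹ by norm_num]
      apply inv_anti₀ (by norm_num)
      calc (5 / 3 : ℝ) ≤ s ^ 1 := by rw [pow_one]; exact hs53
        _ ≤ s ^ j := pow_le_pow_right₀ hs1 (by omega)
    have hVV : Vc F T = Vc F (insert p T) * (1 + y ^ 2) := by
      unfold Vc
      rw [Finset.prod_insert hpT, ← hj, hyx]
      have : 1 + y ^ 2 ≠ 0 := by positivity
      field_simp
    intro n
    rw [Finset.card_insert_of_notMem hpT, pow_succ, ← hK]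
    induction n using Nat.strong_induction_on with
    | _ n ihn =>
      have h1 := ih n
      have hA := Ac_insert F T hT' p hp hpm hpT n
      rw [← hj] at hA
      have hsn : 0 < (s ^ n)⁻¹ := by positivity
      by_cases hn : j ≤ n
      · rw [if_pos hn] at hA
        have h2 := ihn (n - j) (by omega)
        have hqn : ((Fintype.card F : ℝ) ^ n)⁻¹ = y ^ 2 * ((Fintype.card F : ℝ) ^ (n - j))⁻¹ := by
          rw [← hyx, ← mul_inv, ← pow_add]; congr 2; omega
        have hsn' : (s ^ n)⁻¹ = y * (s ^ (n - j))⁻¹ := by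
          rw [hy, ← mul_inv, ← pow_add]; congr 2; omega
        have heq : ((Fintype.card F : ℝ) ^ n)⁻¹ * (Ac F (insert p T) n : ℝ) - Vc F (insert p T) =
            (((Fintype.card F : ℝ) ^ n)⁻¹ * (Ac F T n : ℝ) - Vc F T) -
            y ^ 2 * (((Fintype.card F : ℝ) ^ (n - j))⁻¹ * (Ac F (insert p T) (n - j) : ℝ) - Vc F (insert p T)) := by
          rw [hVV, hA, hqn]; push_cast; ring
        rw [heq]
        refine (abs_sub _ _).trans ?_
        rw [abs_mul, abs_of_nonneg (by positivity : 0 ≤ y ^ 2)]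
        have h3 := mul_le_mul_of_nonneg_left h2 (by positivity : 0 ≤ y ^ 2)
        have h4 : y ^ 2 * (K * (5 / 2) * (s ^ (n - j))⁻¹) = K * (s ^ n)⁻¹ * (y * (5 / 2)) := by
          rw [hsn']; ring
        have h5 : K * (s ^ n)⁻¹ * (y * (5 / 2)) ≤ K * (s ^ n)⁻¹ * (3 / 2) :=
          mul_le_mul_of_nonneg_left (by linarith) (by positivity)
        linarith
      · rw [if_neg hn, add_zero] at hA
        have heq : ((Fintype.card F : ℝ) ^ n)⁻¹ * (Ac F (insert p T) n : ℝ) - Vc F (insert p T) =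
            (((Fintype.card F : ℝ) ^ n)⁻¹ * (Ac F T n : ℝ) - Vc F T) + y ^ 2 * Vc F (insert p T) := by
          rw [hVV, hA]; ring
        rw [heq]
        refine (abs_add_le _ _).trans ?_
        rw [abs_of_nonneg (by positivity : 0 ≤ y ^ 2 * Vc F (insert p T))]
        have h3 : y ^ 2 * Vc F (insert p T) ≤ y ^ 2 := mul_le_of_le_one_right (by positivity) hV1
        have h4 : y ≤ (s ^ n)⁻¹ := by
          rw [hy]
          apply inv_anti₀ (by positivity)
          exact pow_le_pow_right₀ hs1 (by omega)
        have h5 : y ^ 2 ≤ (s ^ n)⁻¹ * 1 := by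
          rw [sq]; exact mul_le_mul h4 (by linarith) hy0.le hsn.le
        have h6 : (s ^ n)⁻¹ ≤ K * (s ^ n)⁻¹ := le_mul_of_one_le_left hsn.le hK1
        linarith

lemma square_sum (v : F[X]) (hv : v.Monic) (n : ℕ) :
    ∑ d ∈ sfs F n, chi F d (v ^ 2) = Ac F (normalizedFactors v).toFinset n := by
  rw [Ac, sfs, Finset.sum_filter]
  refine Finset.sum_congr rfl fun e _ => ?_
  rw [sq, chi_mul_right F e v v hv hv, chi_sq F e v hv]
  by_cases hs : Squarefree e
  · by_cases h : ∃ p ∈ normalizedFactors v, p ∣ e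
    · rw [if_pos hs, if_pos h, if_neg]
      rintro ⟨_, ha⟩
      obtain ⟨p, hp, hpb⟩ := h
      exact ha p (Multiset.mem_toFinset.2 hp) hpb
    · rw [if_pos hs, if_neg h, if_pos]
      refine ⟨hs, ?_⟩
      intro p hp hpb
      exact h ⟨p, Multiset.mem_toFinset.1 hp, hpb⟩
  · rw [if_neg hs, if_neg (fun h => hs h.1)]

lemma tuple_bound (hodd : Odd (Fintype.card F)) {r : ℕ} {lam : Fin r → ℕ} (t : Tup F lam) (n : ℕ) :
    |((Fintype.card F : ℝ) ^ n)⁻¹ * ((∑ d ∈ sfs F n, chi F d (∏ i, ((t i : F[X]))) : ℤ) : ℝ) -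
      (1 - (Fintype.card F : ℝ)⁻¹) * Mterm F (Fintype.card F) t| ≤ 5 ^ (∑ i, lam i) * (Real.sqrt (Fintype.card F) ^ n)⁻¹ := by
  have hq3 : (3 : ℝ) ≤ Fintype.card F := by exact_mod_cast card_ge_three F hodd
  have hmon : (∏ i, ((t i : F[X]))).Monic := monic_prod_of_monic _ _ fun i _ => (t i).2.1
  have hdeg : (∏ i, ((t i : F[X]))).natDegree = ∑ i, lam i := by
    rw [natDegree_prod_of_monic _ _ fun i _ => (t i).2.1]
    exact Finset.sum_congr rfl fun i _ => (t i).2.2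
  set s := Real.sqrt (Fintype.card F) with hs
  have hs2 : s ^ 2 = Fintype.card F := Real.sq_sqrt (by positivity)
  have hspos : 0 < s := Real.sqrt_pos.2 (by linarith)
  unfold Mterm
  split_ifs with h
  · obtain ⟨hv1, hv2⟩ := h.choose_spec
    set v := h.choose with hv
    rw [hv2, square_sum F v hv1 n]
    have hT : ∀ r ∈ (normalizedFactors v).toFinset, Irreducible r ∧ r.Monic := by
      intro r hr
      rw [Multiset.mem_toFinset, mem_nf F hv1.ne_zero] at hr
      exact ⟨hr.1, hr.2.1⟩
    have := Ac_bound F hodd _ hT n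
    refine this.trans ?_
    apply mul_le_mul_of_nonneg_right _ (by positivity)
    rw [hv2, hv1.natDegree_pow] at hdeg
    have hc := card_primes_le F v hv1
    calc ((5:ℝ) / 2) ^ (normalizedFactors v).toFinset.card ≤ 5 ^ (normalizedFactors v).toFinset.card :=
          pow_le_pow_left₀ (by norm_num) (by norm_num) _
      _ ≤ 5 ^ (∑ i, lam i) := pow_le_pow_right₀ (by norm_num) (by omega)
  · have := nonsquare_bound F hodd _ hmon h n
    rw [hdeg] at this
    have hqn : (0:ℝ) ≤ ((Fintype.card F : ℝ) ^ n)⁻¹ := by positivity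
    rw [mul_zero, sub_zero, abs_mul, abs_of_nonneg hqn]
    calc ((Fintype.card F : ℝ) ^ n)⁻¹ * _ ≤ ((Fintype.card F : ℝ) ^ n)⁻¹ * (3 ^ (∑ i, lam i) * s ^ n) :=
          mul_le_mul_of_nonneg_left this hqn
      _ = 3 ^ (∑ i, lam i) * (s ^ n)⁻¹ := by
          rw [← hs2, ← pow_mul]
          field_simp
          ring
      _ ≤ _ := by
          apply mul_le_mul_of_nonneg_right _ (by positivity)
          exact pow_le_pow_left₀ (by norm_num) (by norm_num) _

lemma card_tup {r : ℕ} (lam : Fin r → ℕ) : Fintype.card (Tup F lam) = Fintype.card F ^ (∑ i, lam i) := by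
  rw [Fintype.card_pi, ← Finset.prod_pow_eq_pow_sum]
  refine Finset.prod_congr rfl fun i _ => ?_
  rw [← card_mon, ← Fintype.card_coe]
  exact Fintype.card_congr (Equiv.subtypeEquivRight fun x => (mem_mon F).symm)

lemma sum_SF (n : ℕ) (w : F[X] → ℝ) : ∑ d : SF F n, w (d : F[X]) = ∑ d ∈ sfs F n, w d := by
  rw [← Finset.sum_coe_sort (sfs F n)]
  refine Fintype.sum_equiv (Equiv.subtypeEquivRight fun x => ?_) _ _ fun x => rfl
  rw [mem_sfs]; tauto

theorem statement :
    ∃ C : ℝ, 0 < C ∧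
      ∀ (F : Type) [Field F] [Fintype F], ∀ q : ℕ, Fintype.card F = q → Odd q →
        ∀ r : ℕ, 1 ≤ r → ∀ lam : Fin r → ℕ, ∀ n : ℕ, 1 ≤ n →
          |((q : ℝ) ^ n)⁻¹ * ∑ d : SF F n, (Nlam F lam (d : F[X]) : ℝ) -
              (1 - (q : ℝ)⁻¹) * Mlam F q lam| ≤
            C * 5 ^ (∑ i, lam i) * (q : ℝ) ^ (((∑ i, lam i : ℕ) : ℝ) - n / 2) := by
  refine ⟨1, one_pos, ?_⟩
  intro F _ _ q hq hodd r _ lam n _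
  subst hq
  have hqpos : (0 : ℝ) < Fintype.card F := by exact_mod_cast Fintype.card_pos
  rw [sum_SF F n (fun d => (Nlam F lam d : ℝ))]
  have h1 : ∑ d ∈ sfs F n, (Nlam F lam d : ℝ) = ∑ t : Tup F lam, ((∑ d ∈ sfs F n, chi F d (∏ i, ((t i : F[X]))) : ℤ) : ℝ) := by
    rw [← Int.cast_sum, ← Int.cast_sum]
    congr 1
    unfold Nlam
    rw [Finset.sum_comm]
    refine Finset.sum_congr rfl fun t _ => Finset.sum_congr rfl fun d _ => ?_
    exact chi_prod F _ d (fun i => (t i : F[X])) (fun i => (t i).2.1)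
  rw [h1, Mlam, Finset.mul_sum, Finset.mul_sum, ← Finset.sum_sub_distrib]
  refine (Finset.abs_sum_le_sum_abs _ _).trans ?_
  refine (Finset.sum_le_sum fun t _ => tuple_bound F hodd t n).trans ?_
  rw [Finset.sum_const, Finset.card_univ, card_tup, nsmul_eq_mul, Real.rpow_sub hqpos, Real.rpow_natCast, one_mul]
  have h2 : (Fintype.card F : ℝ) ^ ((n : ℝ) / 2) = Real.sqrt (Fintype.card F) ^ n := by
    rw [Real.sqrt_eq_rpow, ← Real.rpow_natCast, ← Real.rpow_mul hqpos.le]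
    congr 1; ring
  rw [h2]
  push_cast
  apply le_of_eq
  rw [div_eq_mul_inv]; ring

end Stmt6
end
end

section
/- (Jimbo–Miwa identity.) Let g ≥ 1 and r ≥ 1 be integers. In the rational function field ℚ(x₁,…,x_g,t₁,…,t_r) one has ∏_{i=1}^g ∏_{j=1}^r ( x_i + x_i^{−1} + t_j + t_j^{−1} ) = Σ_{λ ⊆ (r^g)} s⟨λ⟩(x₁^{±1},…,x_g^{±1}) · s⟨λ†⟩(t₁^{±1},…,t_r^{±1}), where the sum is over all partitions λ with λ₁ ≤ r and at most g parts, λ' = (λ'₁ ≥ … ≥ λ'_r ≥ 0) is the conjugate partition of λ padded with zeros to r parts, and λ† := (g−λ'_r ≥ g−λ'_{r−1} ≥ … ≥ g−λ'₁) is a partition with at most r parts. -/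
/-!
(Jimbo–Miwa identity.)  For a partition `μ = (μ₁ ≥ … ≥ μ_m ≥ 0)` the symplectic Schur
function in the variables `y₁^{±1},…,y_m^{±1}` is given by the Weyl character formula
`s⟨μ⟩(y^±) = det(y_i^{μ_j+m−j+1} − y_i^{−(μ_j+m−j+1)}) / det(y_i^{m−j+1} − y_i^{−(m−j+1)})`.

Statement: in `ℚ(x₁,…,x_g,t₁,…,t_r)`:
`∏_{i=1}^g ∏_{j=1}^r (x_i + x_i⁻¹ + t_j + t_j⁻¹)
   = Σ_{λ ⊆ (r^g)} s⟨λ⟩(x^±) · s⟨λ†⟩(t^±)`,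
the sum over all partitions `λ` with `λ₁ ≤ r` and at most `g` parts (encoded below as
antitone functions `Fin g → {0,…,r}`), where `λ'` is the conjugate partition padded
with zeros to `r` parts and `λ† = (g−λ'_r ≥ … ≥ g−λ'₁)`.
-/

noncomputable section

open scoped Classical

namespace Stmt10

/-- The rational function field `ℚ(x₁,…,x_g,t₁,…,t_r)`. -/
abbrev K (g r : ℕ) : Type := FractionRing (MvPolynomial (Fin g ⊕ Fin r) ℚ)

/-- The variable `x_i`. -/
def x (g r : ℕ) (i : Fin g) : K g r :=
  algebraMap (MvPolynomial (Fin g ⊕ Fin r) ℚ) (K g r) (MvPolynomial.X (Sum.inl i))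

/-- The variable `t_j`. -/
def t (g r : ℕ) (j : Fin r) : K g r :=
  algebraMap (MvPolynomial (Fin g ⊕ Fin r) ℚ) (K g r) (MvPolynomial.X (Sum.inr j))

/-- The symplectic Schur function, by the Weyl character formula:
`s⟨μ⟩(y^±) = det(y_i^{μ_j+m−j+1} − y_i^{−(μ_j+m−j+1)}) / det(y_i^{m−j+1} − y_i^{−(m−j+1)})`
(the column index `j` below is 0-based, so `m−j+1` (1-based) becomes `m−j` (0-based)). -/
def sympSchur {L : Type} [Field L] (m : ℕ) (μ : Fin m → ℕ) (y : Fin m → L) : L :=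
  Matrix.det (Matrix.of fun i j : Fin m =>
      y i ^ ((μ j : ℤ) + ((m : ℤ) - (j : ℕ))) -
        y i ^ (-((μ j : ℤ) + ((m : ℤ) - (j : ℕ))))) /
    Matrix.det (Matrix.of fun i j : Fin m =>
      y i ^ ((m : ℤ) - (j : ℕ)) - y i ^ (-((m : ℤ) - (j : ℕ))))

/-- The partition `λ† = (g−λ'_r ≥ … ≥ g−λ'₁)` associated to a partition
`λ ⊆ (r^g)` (encoded by `f : Fin g → Fin (r+1)`):
`λ†_{k+1} = g − λ'_{r−k} = g − #{i : λ_i ≥ r−k}` (0-based `k`). -/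
def dag (g r : ℕ) (f : Fin g → Fin (r + 1)) (k : Fin r) : ℕ :=
  g - (Finset.univ.filter fun i : Fin g => r - (k : ℕ) ≤ (f i : ℕ)).card

/-! ### Chebyshev-type polynomials -/

/-- Monic polynomials with `P n (z + 1/z) = (z^(n+1) - z^(-n-1)) / (z - 1/z)`. -/
def P (L : Type) [Field L] : ℕ → Polynomial L
  | 0 => 1
  | 1 => Polynomial.X
  | n + 2 => Polynomial.X * P L (n + 1) - P L n

theorem P_deg (L : Type) [Field L] (n : ℕ) : (P L n).Monic ∧ (P L n).natDegree = n := by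
  induction n using Nat.strong_induction_on with
  | _ n ih =>
    match n with
    | 0 => simp [P]
    | 1 => simp [P, Polynomial.monic_X]
    | n + 2 =>
      obtain ⟨h1, h2⟩ := ih (n + 1) (by omega)
      obtain ⟨h3, h4⟩ := ih n (by omega)
      have hm : (Polynomial.X * P L (n + 1)).Monic := Polynomial.monic_X.mul h1
      have hd : (Polynomial.X * P L (n + 1)).natDegree = n + 2 := by
        rw [Polynomial.monic_X.natDegree_mul h1, h2]; simp; ring
      have hlt : (P L n).degree < (Polynomial.X * P L (n + 1)).degree := by
        apply Polynomial.degree_lt_degree; omega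
      refine ⟨hm.sub_of_left hlt, ?_⟩
      rw [P, Polynomial.natDegree_sub_eq_left_of_natDegree_lt (by omega), hd]

theorem P_neg (L : Type) [Field L] (n : ℕ) (z : L) :
    (P L n).eval (-z) = (-1) ^ n * (P L n).eval z := by
  induction n using Nat.strong_induction_on with
  | _ n ih =>
    match n with
    | 0 => simp [P]
    | 1 => simp [P]
    | n + 2 =>
      have h1 := ih (n + 1) (by omega)
      have h2 := ih n (by omega)
      simp only [P, Polynomial.eval_sub, Polynomial.eval_mul, Polynomial.eval_X, h1, h2]
      ring

theorem P_eval (L : Type) [Field L] (n : ℕ) (z : L) (hz : z ≠ 0) :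
    (z - z⁻¹) * (P L n).eval (z + z⁻¹) = z ^ (n + 1) - (z⁻¹) ^ (n + 1) := by
  induction n using Nat.strong_induction_on with
  | _ n ih =>
    match n with
    | 0 => simp [P]
    | 1 => simp [P]; ring
    | n + 2 =>
      have h1 := ih (n + 1) (by omega)
      have h2 := ih n (by omega)
      have h3 : z * z⁻¹ = 1 := mul_inv_cancel₀ hz
      simp only [P, Polynomial.eval_sub, Polynomial.eval_mul, Polynomial.eval_X]
      linear_combination (z + z⁻¹) * h1 - h2 + (z ^ (n + 1) - z⁻¹ ^ (n + 1)) * h3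

theorem det_P (L : Type) [Field L] (m : ℕ) (w : Fin m → L) :
    (Matrix.of fun i j : Fin m => (P L (j : ℕ)).eval (w i)).det = (Matrix.vandermonde w).det :=
  (Matrix.det_eval_matrixOfPolynomials_eq_det_vandermonde w (fun j => P L (j : ℕ))
    (fun i => (P_deg L i).2) (fun i => (P_deg L i).1)).symm

theorem sympSchur_eq {L : Type} [Field L] (m : ℕ) (μ : Fin m → ℕ) (y : Fin m → L)
    (hy : ∀ i, y i ≠ 0) (hy2 : ∀ i, y i - (y i)⁻¹ ≠ 0) :
    sympSchur m μ y =
      (Matrix.of fun i j : Fin m =>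
        (P L (μ (Fin.rev j) + j)).eval (y i + (y i)⁻¹)).det /
      (Matrix.vandermonde fun i => y i + (y i)⁻¹).det := by
  have key : ∀ ν : Fin m → ℕ,
      Matrix.det (Matrix.of fun i j : Fin m =>
        y i ^ ((ν j : ℤ) + ((m : ℤ) - (j : ℕ))) -
          y i ^ (-((ν j : ℤ) + ((m : ℤ) - (j : ℕ))))) =
      (∏ i, (y i - (y i)⁻¹)) * ((Equiv.Perm.sign (Fin.revPerm : Equiv.Perm (Fin m)) : ℤ) : L) *
      (Matrix.of fun i j : Fin m =>
        (P L (ν (Fin.rev j) + j)).eval (y i + (y i)⁻¹)).det := by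
    intro ν
    rw [mul_assoc, ← Matrix.det_permute', ← Matrix.det_mul_column]
    congr 1
    ext i j
    simp only [Matrix.of_apply, Matrix.submatrix_apply, id, Fin.revPerm_apply, Fin.rev_rev]
    rw [P_eval L _ _ (hy i)]
    have : ((ν j : ℤ) + ((m : ℤ) - (j : ℕ))) = ((ν j + (Fin.rev j : ℕ) + 1 : ℕ) : ℤ) := by
      have := j.isLt
      rw [Fin.val_rev]; omega
    rw [this, zpow_neg, zpow_natCast, inv_pow]
  have h0 := key (fun _ => 0)
  simp only [Nat.cast_zero, zero_add] at h0
  rw [det_P] at h0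
  rw [sympSchur, key, h0, mul_div_mul_left]
  apply mul_ne_zero (Finset.prod_ne_zero_iff.2 fun i _ => hy2 i)
  rcases Int.units_eq_one_or (Equiv.Perm.sign (Fin.revPerm : Equiv.Perm (Fin m))) with h | h <;>
    rw [h] <;> simp

/-! ### Splitting products over ordered pairs -/

theorem prod_pairs {M : Type} [CommMonoid M] (g r : ℕ) (F : Fin (g + r) → Fin (g + r) → M) :
    ∏ i, ∏ j ∈ Finset.Ioi i, F i j =
      (∏ i : Fin g, ∏ j ∈ Finset.Ioi i, F (Fin.castAdd r i) (Fin.castAdd r j)) *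
      (∏ i : Fin r, ∏ j ∈ Finset.Ioi i, F (Fin.natAdd g i) (Fin.natAdd g j)) *
      ∏ i : Fin g, ∏ k : Fin r, F (Fin.castAdd r i) (Fin.natAdd g k) := by
  have h : ∀ (n : ℕ) (G : Fin n → Fin n → M) (i : Fin n),
      ∏ j ∈ Finset.Ioi i, G i j = ∏ j, if i < j then G i j else 1 := by
    intro n G i
    rw [← Finset.prod_filter]
    congr 1
    ext j; simp
  rw [Fin.prod_univ_add]
  simp only [h]
  simp only [Fin.prod_univ_add, Finset.prod_mul_distrib]
  have e1 : ∀ (i : Fin g) (j : Fin g), (Fin.castAdd r i < Fin.castAdd r j) ↔ i < j := by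
    intro i j; exact Iff.rfl
  have e2 : ∀ (i : Fin r) (j : Fin r), (Fin.natAdd g i < Fin.natAdd g j) ↔ i < j := by
    intro i j; simp
  have e3 : ∀ (i : Fin g) (j : Fin r), (Fin.castAdd r i < Fin.natAdd g j) := by
    intro i j; simp [Fin.lt_def]; omega
  have e4 : ∀ (i : Fin r) (j : Fin g), ¬ (Fin.natAdd g i < Fin.castAdd r j) := by
    intro i j; simp [Fin.lt_def]; omega
  have q1 := fun i : Fin g => h g (fun i j => F (Fin.castAdd r i) (Fin.castAdd r j)) i
  have q2 := fun i : Fin r => h r (fun i j => F (Fin.natAdd g i) (Fin.natAdd g j)) i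
  simp only [q1, q2, e1, e2, e3, e4, if_true, if_false, Finset.prod_const_one, one_mul]
  rw [mul_assoc, mul_assoc, mul_comm (∏ i : Fin g, ∏ k : Fin r, _)]

/-! ### The two complementary index sets -/

/-- Increasing exponents attached to `λ`. -/
def av (g r : ℕ) (f : Fin g → Fin (r + 1)) (i : Fin g) : ℕ := (f (Fin.rev i) : ℕ) + i

/-- Increasing exponents attached to `λ†`. -/
def bv (g r : ℕ) (f : Fin g → Fin (r + 1)) (k : Fin r) : ℕ := dag g r f (Fin.rev k) + k

theorem dag_rev (g r : ℕ) (f : Fin g → Fin (r + 1)) (k : Fin r) :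
    dag g r f (Fin.rev k) = (Finset.univ.filter fun i : Fin g => (f (Fin.rev i) : ℕ) ≤ k).card := by
  have h1 : r - (Fin.rev k : ℕ) = k + 1 := by
    have := k.isLt
    rw [Fin.val_rev]; omega
  have h2 : (Finset.univ.filter fun i : Fin g => (f (Fin.rev i) : ℕ) ≤ k).card =
      (Finset.univ.filter fun i : Fin g => (f i : ℕ) ≤ k).card := by
    apply Finset.card_bij (fun i _ => Fin.rev i)
    · intro i; simp
    · intro i _ j _ h; simpa using h
    · intro i hi; exact ⟨Fin.rev i, by simpa using hi, by simp⟩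
  rw [dag, h1, h2]
  have h3 := Finset.card_filter_add_card_filter_not (s := (Finset.univ : Finset (Fin g)))
    (fun i : Fin g => (k : ℕ) + 1 ≤ (f i : ℕ))
  simp only [not_le, Nat.lt_succ_iff, Finset.card_univ, Fintype.card_fin] at h3
  omega

theorem cross (g r : ℕ) (f : Fin g → Fin (r + 1)) (hf : Antitone fun i => (f i : ℕ))
    (i : Fin g) (k : Fin r) :
    ((f (Fin.rev i) : ℕ) ≤ k → av g r f i < bv g r f k) ∧
    (¬ (f (Fin.rev i) : ℕ) ≤ k → bv g r f k < av g r f i) := by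
  have hm : ∀ i j : Fin g, i ≤ j → (f (Fin.rev i) : ℕ) ≤ f (Fin.rev j) := by
    intro i j h; exact hf (by simpa using h)
  rw [av, bv, dag_rev]
  constructor
  · intro h
    have : (Finset.Iic i).card ≤
        (Finset.univ.filter fun i : Fin g => (f (Fin.rev i) : ℕ) ≤ k).card := by
      apply Finset.card_le_card
      intro j hj
      simp only [Finset.mem_Iic] at hj
      simp only [Finset.mem_filter, Finset.mem_univ, true_and]
      exact (hm _ _ hj).trans h
    rw [Fin.card_Iic] at this
    omega
  · intro h
    have : (Finset.univ.filter fun i : Fin g => (f (Fin.rev i) : ℕ) ≤ k).card ≤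
        (Finset.Iio i).card := by
      apply Finset.card_le_card
      intro j hj
      simp only [Finset.mem_filter, Finset.mem_univ, true_and] at hj
      simp only [Finset.mem_Iio]
      by_contra hc
      exact h ((hm _ _ (not_lt.1 hc)).trans hj)
    rw [Fin.card_Iio] at this
    omega

theorem av_strictMono (g r : ℕ) (f : Fin g → Fin (r + 1)) (hf : Antitone fun i => (f i : ℕ)) :
    StrictMono (av g r f) := by
  intro i j h
  have : (f (Fin.rev i) : ℕ) ≤ f (Fin.rev j) := hf (by simpa using h.le)
  have h' : (i : ℕ) < j := h
  simp only [av]; omega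

theorem bv_strictMono (g r : ℕ) (f : Fin g → Fin (r + 1)) :
    StrictMono (bv g r f) := by
  intro i j h
  have h' : (i : ℕ) < j := h
  have : dag g r f (Fin.rev i) ≤ dag g r f (Fin.rev j) := by
    rw [dag_rev, dag_rev]
    apply Finset.card_le_card
    intro l hl
    simp only [Finset.mem_filter, Finset.mem_univ, true_and] at hl ⊢
    omega
  simp only [bv]; omega

theorem exists_perm (g r : ℕ) (f : Fin g → Fin (r + 1)) (hf : Antitone fun i => (f i : ℕ)) :
    ∃ E : Equiv.Perm (Fin g ⊕ Fin r), (∀ i, (finSumFinEquiv (E (Sum.inl i)) : ℕ) = av g r f i) ∧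
      (∀ k, (finSumFinEquiv (E (Sum.inr k)) : ℕ) = bv g r f k) := by
  have ha : ∀ i, av g r f i < g + r := by
    intro i
    have := (f (Fin.rev i)).isLt
    have := i.isLt
    rw [av]; omega
  have hb : ∀ k, bv g r f k < g + r := by
    intro k
    have := k.isLt
    have : dag g r f (Fin.rev k) ≤ g := Nat.sub_le _ _
    rw [bv]; omega
  let e : Fin g ⊕ Fin r → Fin (g + r) :=
    Sum.elim (fun i => ⟨av g r f i, ha i⟩) (fun k => ⟨bv g r f k, hb k⟩)
  have hne : ∀ i k, av g r f i ≠ bv g r f k := by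
    intro i k
    by_cases h : (f (Fin.rev i) : ℕ) ≤ k
    · exact ((cross g r f hf i k).1 h).ne
    · exact ((cross g r f hf i k).2 h).ne'
  have he : Function.Injective e := by
    rintro (i | k) (j | l) h
    · simp only [e, Sum.elim_inl, Fin.mk.injEq] at h
      rw [(av_strictMono g r f hf).injective h]
    · simp only [e, Sum.elim_inl, Sum.elim_inr, Fin.mk.injEq] at h
      exact absurd h (hne _ _)
    · simp only [e, Sum.elim_inl, Sum.elim_inr, Fin.mk.injEq] at h
      exact absurd h.symm (hne _ _)
    · simp only [e, Sum.elim_inr, Fin.mk.injEq] at h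
      rw [(bv_strictMono g r f).injective h]
  have hinj : Function.Injective (fun p => finSumFinEquiv.symm (e p)) :=
    finSumFinEquiv.symm.injective.comp he
  refine ⟨Equiv.ofBijective _ (Finite.injective_iff_bijective.1 hinj), ?_, ?_⟩
  · intro i; simp [e]
  · intro k; simp [e]

/-- The permutation attached to `λ`. -/
def E (g r : ℕ) (f : Fin g → Fin (r + 1)) : Equiv.Perm (Fin g ⊕ Fin r) :=
  if hf : Antitone fun i => (f i : ℕ) then (exists_perm g r f hf).choose else 1

theorem E_spec (g r : ℕ) (f : Fin g → Fin (r + 1)) (hf : Antitone fun i => (f i : ℕ)) :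
    (∀ i, (finSumFinEquiv (E g r f (Sum.inl i)) : ℕ) = av g r f i) ∧
      (∀ k, (finSumFinEquiv (E g r f (Sum.inr k)) : ℕ) = bv g r f k) := by
  rw [E, dif_pos hf]
  exact (exists_perm g r f hf).choose_spec

theorem sign_E (g r : ℕ) (f : Fin g → Fin (r + 1)) (hf : Antitone fun i => (f i : ℕ)) :
    Equiv.Perm.sign (E g r f) =
      ∏ i : Fin g, ∏ k : Fin r, if (f (Fin.rev i) : ℕ) ≤ k then 1 else -1 := by
  obtain ⟨h1, h2⟩ := E_spec g r f hf
  rw [← Equiv.Perm.sign_permCongr finSumFinEquiv, Equiv.Perm.sign_eq_prod_prod_Ioi, prod_pairs]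
  have c1 : ∀ i, (finSumFinEquiv.permCongr (E g r f) (Fin.castAdd r i) : ℕ) = av g r f i := by
    intro i; rw [← h1]; simp [Equiv.permCongr_apply]
  have c2 : ∀ i, (finSumFinEquiv.permCongr (E g r f) (Fin.natAdd g i) : ℕ) = bv g r f i := by
    intro i; rw [← h2]; simp [Equiv.permCongr_apply]
  simp only [Fin.lt_def, c1, c2]
  rw [Finset.prod_eq_one, Finset.prod_eq_one, one_mul, one_mul]
  · refine Finset.prod_congr rfl fun i _ => Finset.prod_congr rfl fun k _ => ?_
    by_cases h : (f (Fin.rev i) : ℕ) ≤ k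
    · rw [if_pos h, if_pos ((cross g r f hf i k).1 h)]
    · rw [if_neg h, if_neg ((cross g r f hf i k).2 h).not_gt]
  · intro i _
    refine Finset.prod_eq_one fun j hj => if_pos (bv_strictMono g r f (Finset.mem_Ioi.1 hj))
  · intro i _
    refine Finset.prod_eq_one fun j hj => if_pos (av_strictMono g r f hf (Finset.mem_Ioi.1 hj))

/-- Sign bookkeeping. -/
theorem sign_E_mul {L : Type} [Field L] (g r : ℕ) (f : Fin g → Fin (r + 1))
    (hf : Antitone fun i => (f i : ℕ)) :
    ((Equiv.Perm.sign (E g r f) : ℤ) : L) * ∏ k : Fin r, (-1 : L) ^ bv g r f k =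
      (∏ k : Fin r, (-1 : L) ^ (k : ℕ)) * ∏ _i : Fin g, ∏ _k : Fin r, (-1 : L) := by
  rw [sign_E g r f hf]
  have hd : ∀ k : Fin r, (-1 : L) ^ dag g r f (Fin.rev k) =
      ∏ i : Fin g, if (f (Fin.rev i) : ℕ) ≤ k then (-1 : L) else 1 := by
    intro k
    rw [dag_rev, ← Finset.prod_filter, Finset.prod_const]
  simp only [bv, pow_add, Finset.prod_mul_distrib, hd]
  rw [Finset.prod_comm (s := (Finset.univ : Finset (Fin r)))]
  push_cast
  rw [← mul_assoc, mul_comm, ← Finset.prod_mul_distrib]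
  congr 1
  simp only [← Finset.prod_mul_distrib]
  refine Finset.prod_congr rfl fun i _ => Finset.prod_congr rfl fun k _ => ?_
  split_ifs <;> simp

/-! ### Laplace expansion -/

theorem E_inj (g r : ℕ) (f f' : Fin g → Fin (r + 1)) (hf : Antitone fun i => (f i : ℕ))
    (hf' : Antitone fun i => (f' i : ℕ)) (σ σ' : Equiv.Perm (Fin g) × Equiv.Perm (Fin r))
    (h : E g r f * Equiv.Perm.sumCongrHom _ _ σ = E g r f' * Equiv.Perm.sumCongrHom _ _ σ') :
    f = f' ∧ σ = σ' := by
  have key : ∀ i, av g r f (σ.1 i) = av g r f' (σ'.1 i) := by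
    intro i
    rw [← (E_spec g r f hf).1, ← (E_spec g r f' hf').1]
    have := congrArg (fun e => (finSumFinEquiv (e (Sum.inl i)) : ℕ)) h
    simpa using this
  have hr : Set.range (av g r f) = Set.range (av g r f') := by
    rw [← σ.1.surjective.range_comp (av g r f), ← σ'.1.surjective.range_comp (av g r f')]
    congr 1
    ext i; exact key i
  have hav : av g r f = av g r f' :=
    (StrictMono.range_inj (av_strictMono g r f hf) (av_strictMono g r f' hf')).1 hr
  have hff : f = f' := by
    ext i
    have := congrFun hav (Fin.rev i)
    simpa [av] using this
  subst hff
  exact ⟨rfl, Equiv.Perm.sumCongrHom_injective (mul_left_cancel h)⟩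

theorem E_surj (g r : ℕ) (σ : Equiv.Perm (Fin g ⊕ Fin r)) :
    ∃ f : Fin g → Fin (r + 1), (Antitone fun i => (f i : ℕ)) ∧
      ∃ τ, E g r f * Equiv.Perm.sumCongrHom _ _ τ = σ := by
  let S : Finset (Fin (g + r)) := Finset.univ.map
    ⟨fun i : Fin g => finSumFinEquiv (σ (Sum.inl i)),
      finSumFinEquiv.injective.comp (σ.injective.comp Sum.inl_injective)⟩
  have hS : S.card = g := by simp [S]
  let a := S.orderEmbOfFin hS
  have hge : ∀ i : Fin g, (i : ℕ) ≤ a i := by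
    intro i
    have h := (Finset.card_le_card_of_injOn (s := Finset.Iio i) (t := Finset.Iio (a i)) a
      (by intro j hj; simpa using hj) a.injective.injOn)
    simpa using h
  have hmono : ∀ i j : Fin g, i ≤ j → (a i : ℕ) + (j : ℕ) ≤ a j + i := by
    intro i j hij
    have h := (Finset.card_le_card_of_injOn (s := Finset.Ico i j) (t := Finset.Ico (a i) (a j)) a
      (by intro l hl; simpa using hl) a.injective.injOn)
    have h1 : (a i : ℕ) ≤ a j := a.monotone hij
    have h2 : (i : ℕ) ≤ j := hij
    simp only [Fin.card_Ico] at h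
    omega
  have hle : ∀ i : Fin g, (a i : ℕ) - i < r + 1 := by
    intro i
    have h := (Finset.card_le_card_of_injOn (s := Finset.Ioi i) (t := Finset.Ioi (a i)) a
      (by intro l hl; simpa using hl) a.injective.injOn)
    simp only [Fin.card_Ioi] at h
    have := (a i).isLt
    have := i.isLt
    omega
  let f : Fin g → Fin (r + 1) := fun i => ⟨(a (Fin.rev i) : ℕ) - (Fin.rev i : ℕ), hle _⟩
  have hf : Antitone fun i => (f i : ℕ) := by
    intro i j hij
    have := hmono (Fin.rev j) (Fin.rev i) (by simpa using hij)
    have := hge (Fin.rev i)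
    have := hge (Fin.rev j)
    simp only [f]
    omega
  have hav : ∀ i, av g r f i = a i := by
    intro i
    have := hge i
    simp only [av, f, Fin.rev_rev]; omega
  refine ⟨f, hf, ?_⟩
  have hmem : (E g r f)⁻¹ * σ ∈ (Equiv.Perm.sumCongrHom (Fin g) (Fin r)).range := by
    apply Equiv.Perm.mem_sumCongrHom_range_of_perm_mapsTo_inl
    rintro _ ⟨i, rfl⟩
    have : finSumFinEquiv (σ (Sum.inl i)) ∈ Set.range a := by
      rw [Finset.range_orderEmbOfFin]
      simp [S]
    obtain ⟨j, hj⟩ := this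
    refine ⟨j, ?_⟩
    rw [Equiv.Perm.mul_apply, Equiv.Perm.eq_inv_iff_eq]
    apply finSumFinEquiv.injective
    rw [← hj]
    apply Fin.ext
    rw [(E_spec g r f hf).1, hav]
  obtain ⟨τ, hτ⟩ := hmem
  exact ⟨τ, by rw [hτ]; simp⟩

theorem laplace {L : Type} [Field L] (g r : ℕ) (B : Fin g ⊕ Fin r → ℕ → L) :
    (Matrix.of fun p q : Fin g ⊕ Fin r => B p (finSumFinEquiv q : ℕ)).det =
      ∑ f ∈ (Finset.univ : Finset (Fin g → Fin (r + 1))).filter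
          (fun f => Antitone fun i => (f i : ℕ)),
        ((Equiv.Perm.sign (E g r f) : ℤ) : L) *
          ((Matrix.of fun i j : Fin g => B (Sum.inl i) (av g r f j)).det *
          (Matrix.of fun i j : Fin r => B (Sum.inr i) (bv g r f j)).det) := by
  have hdet : ∀ {n : Type} [Fintype n] [DecidableEq n] (M : Matrix n n L),
      M.det = ∑ σ : Equiv.Perm n, ((Equiv.Perm.sign σ : ℤ) : L) * ∏ i, M i (σ i) := by
    intro n _ _ M
    rw [← Matrix.det_transpose, Matrix.det_apply']
    rfl
  simp only [hdet]
  simp only [Finset.sum_mul_sum]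
  simp only [← Finset.sum_product', Finset.univ_product_univ]
  simp only [Finset.mul_sum]
  rw [← Finset.sum_product']
  symm
  refine Finset.sum_bij
    (fun p _ => E g r p.1 * Equiv.Perm.sumCongrHom _ _ p.2) ?_ ?_ ?_ ?_
  · intro p _; exact Finset.mem_univ _
  · rintro ⟨f, σ⟩ hp ⟨f', σ'⟩ hp' h
    simp only [Finset.mem_product, Finset.mem_filter, Finset.mem_univ, true_and, and_true] at hp hp'
    obtain ⟨h1, h2⟩ := E_inj g r f f' hp hp' σ σ' h
    rw [h1, h2]
  · intro σ _
    obtain ⟨f, hf, τ, h⟩ := E_surj g r σ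
    exact ⟨(f, τ), by simpa using hf, h⟩
  · rintro ⟨f, σ, τ⟩ hp
    simp only [Finset.mem_product, Finset.mem_filter, Finset.mem_univ, true_and, and_true] at hp
    obtain ⟨h1, h2⟩ := E_spec g r f hp
    simp only [Equiv.Perm.sumCongrHom_apply, Equiv.Perm.sign_mul, Equiv.Perm.sign_sumCongr,
      Fintype.prod_sum_type, Matrix.of_apply, Equiv.Perm.mul_apply, Equiv.Perm.sumCongr_apply,
      Sum.map_inl, Sum.map_inr, h1, h2]
    push_cast
    ring

theorem dualCauchy {L : Type} [Field L] (g r : ℕ) (w : Fin g → L) (u : Fin r → L) :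
    (∏ i, ∏ k, (w i + u k)) * ((Matrix.vandermonde w).det * (Matrix.vandermonde u).det) =
      ∑ f ∈ (Finset.univ : Finset (Fin g → Fin (r + 1))).filter
          (fun f => Antitone fun i => (f i : ℕ)),
        (Matrix.of fun i j : Fin g => (P L (av g r f j)).eval (w i)).det *
          (Matrix.of fun i j : Fin r => (P L (bv g r f j)).eval (u i)).det := by
  set c : L := (∏ k : Fin r, (-1 : L) ^ (k : ℕ)) * ∏ _i : Fin g, ∏ _k : Fin r, (-1 : L) with hc
  have hc0 : c ≠ 0 := by
    simp [hc, Finset.prod_ne_zero_iff]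
  apply mul_left_cancel₀ hc0
  have hL := laplace g r (fun p n => (P L n).eval (Sum.elim w (fun k => - u k) p))
  have hcol : ∀ b : Fin r → ℕ,
      (Matrix.of fun i j : Fin r => (P L (b j)).eval (- u i)).det =
      (∏ j, (-1 : L) ^ b j) * (Matrix.of fun i j : Fin r => (P L (b j)).eval (u i)).det := by
    intro b
    rw [← Matrix.det_mul_row]
    congr 1
    ext i j
    simp [P_neg]
  have hneg : (Matrix.vandermonde fun k => - u k).det =
      (∏ k : Fin r, (-1 : L) ^ (k : ℕ)) * (Matrix.vandermonde u).det := by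
    rw [← det_P, ← det_P, hcol]
  have hfull : (Matrix.of fun p q : Fin g ⊕ Fin r =>
      (P L (finSumFinEquiv q : ℕ)).eval (Sum.elim w (fun k => - u k) p)).det =
      c * ((∏ i, ∏ k, (w i + u k)) *
        ((Matrix.vandermonde w).det * (Matrix.vandermonde u).det)) := by
    rw [← Matrix.det_submatrix_equiv_self finSumFinEquiv.symm]
    have := det_P L (g + r) (fun i => Sum.elim w (fun k => - u k) (finSumFinEquiv.symm i))
    rw [Matrix.det_vandermonde, prod_pairs] at this
    simp only [finSumFinEquiv_symm_apply_castAdd, finSumFinEquiv_symm_apply_natAdd,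
      Sum.elim_inl, Sum.elim_inr] at this
    rw [← Matrix.det_vandermonde w, ← Matrix.det_vandermonde fun k => - u k, hneg] at this
    have hx : ∏ i, ∏ k, (- u k - w i) =
        (∏ _i : Fin g, ∏ _k : Fin r, (-1 : L)) * ∏ i, ∏ k, (w i + u k) := by
      simp only [← Finset.prod_mul_distrib]
      refine Finset.prod_congr rfl fun i _ => Finset.prod_congr rfl fun k _ => ?_
      ring
    rw [hx] at this
    have h2 : ((Matrix.of fun p q : Fin g ⊕ Fin r =>
      (P L (finSumFinEquiv q : ℕ)).eval (Sum.elim w (fun k => - u k) p)).submatrix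
        finSumFinEquiv.symm finSumFinEquiv.symm) = (Matrix.of fun i j : Fin (g + r) =>
        (P L (j : ℕ)).eval (Sum.elim w (fun k => - u k) (finSumFinEquiv.symm i))) := by
      ext i j; simp
    rw [h2, this, hc]
    ring
  rw [← hfull, hL, Finset.mul_sum]
  refine Finset.sum_congr rfl fun f hf => ?_
  have hf' := (Finset.mem_filter.1 hf).2
  simp only [Sum.elim_inl, Sum.elim_inr]
  rw [hcol, hc, ← sign_E_mul g r f hf']
  ring

/-! ### Genericity of the variables -/

theorem var_generic (g r : ℕ) :
    let z := fun p => algebraMap (MvPolynomial (Fin g ⊕ Fin r) ℚ) (K g r) (MvPolynomial.X p)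
    (∀ p, z p ≠ 0) ∧ (∀ p q, z p * z q ≠ 1) ∧ Function.Injective z := by
  intro z
  have hinj := IsFractionRing.injective (MvPolynomial (Fin g ⊕ Fin r) ℚ) (K g r)
  refine ⟨fun p h => ?_, fun p q h => ?_, fun p q h => ?_⟩
  · exact MvPolynomial.X_ne_zero p (hinj (by rw [map_zero]; exact h))
  · have h' : (MvPolynomial.X p * MvPolynomial.X q : MvPolynomial (Fin g ⊕ Fin r) ℚ) = 1 :=
      hinj (by rw [map_mul, map_one]; exact h)
    have := congrArg (MvPolynomial.eval (fun _ => (0 : ℚ))) h'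
    simp at this
  · exact MvPolynomial.X_injective (hinj h)

theorem generic_sub {L : Type} [Field L] (z : L) (h0 : z ≠ 0) (h1 : z * z ≠ 1) :
    z - z⁻¹ ≠ 0 := by
  intro h
  apply h1
  have : z = z⁻¹ := sub_eq_zero.1 h
  nth_rewrite 2 [this]
  exact mul_inv_cancel₀ h0

theorem generic_vand {L : Type} [Field L] (m : ℕ) (y : Fin m → L) (h0 : ∀ i, y i ≠ 0)
    (h1 : ∀ i j, y i * y j ≠ 1) (h2 : Function.Injective y) :
    (Matrix.vandermonde fun i => y i + (y i)⁻¹).det ≠ 0 := by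
  rw [Matrix.det_vandermonde_ne_zero_iff]
  intro i j h
  apply h2
  have a := h0 i
  have b := h0 j
  have : (y i - y j) * (y i * y j - 1) = 0 := by
    simp only at h
    field_simp at h
    linear_combination h
  rcases mul_eq_zero.1 this with h | h
  · exact sub_eq_zero.1 h
  · exact absurd (sub_eq_zero.1 h) (h1 i j)

theorem statement (g r : ℕ) (hg : 1 ≤ g) (hr : 1 ≤ r) :
    (∏ i : Fin g, ∏ j : Fin r,
        (x g r i + (x g r i)⁻¹ + t g r j + (t g r j)⁻¹)) =
      ∑ f : Fin g → Fin (r + 1),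
        if Antitone (fun i => ((f i : ℕ))) then
          sympSchur g (fun i => ((f i : ℕ))) (x g r) *
            sympSchur r (dag g r f) (t g r)
        else 0 := by
  obtain ⟨z0, z1, z2⟩ := var_generic g r
  have hx0 : ∀ i, x g r i ≠ 0 := fun i => z0 _
  have ht0 : ∀ i, t g r i ≠ 0 := fun i => z0 _
  have hx1 : ∀ i j, x g r i * x g r j ≠ 1 := fun i j => z1 _ _
  have ht1 : ∀ i j, t g r i * t g r j ≠ 1 := fun i j => z1 _ _
  have hx2 : Function.Injective (x g r) := z2.comp Sum.inl_injective
  have ht2 : Function.Injective (t g r) := z2.comp Sum.inr_injective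
  have hxv := generic_vand g (x g r) hx0 hx1 hx2
  have htv := generic_vand r (t g r) ht0 ht1 ht2
  have hD := dualCauchy g r (fun i => x g r i + (x g r i)⁻¹) (fun k => t g r k + (t g r k)⁻¹)
  rw [← Finset.sum_filter]
  have hP : (∏ i : Fin g, ∏ j : Fin r,
        (x g r i + (x g r i)⁻¹ + t g r j + (t g r j)⁻¹)) =
      ∏ i : Fin g, ∏ j : Fin r,
        (x g r i + (x g r i)⁻¹ + (t g r j + (t g r j)⁻¹)) := by
    simp only [add_assoc]
  rw [hP, eq_div_of_mul_eq (mul_ne_zero hxv htv) hD, Finset.sum_div]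
  refine Finset.sum_congr rfl fun f _ => ?_
  rw [sympSchur_eq g _ (x g r) hx0 (fun i => generic_sub _ (hx0 i) (hx1 i i)),
    sympSchur_eq r _ (t g r) ht0 (fun i => generic_sub _ (ht0 i) (ht1 i i)), div_mul_div_comm]
  rfl

end Stmt10
end
end
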